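/- Let ψ be a function in the class F, β ∈ ℝ. Then there exists a constant C = C(ψ) > 0 such that for all natural numbers n, p with 1 ≤ p ≤ n and all β ∈ ℝ, |E(C^ψ_{β,∞}; U^ψ_{n,p}) − (4/π²)·ψ(n)·A^ψ_{n,p}| ≤ C·ψ(n), where A^ψ_{n,p} = ln p if T(n) ≤ 1; A^ψ_{n,p} = ln(p/T(n)) if 1 ≤ T(n) ≤ p; A^ψ_{n,p} = ln(T(n)/p) if T(n) ≥ p, and T(n) = η(ψ;n) − n with η(ψ;n) = ψ⁻¹(ψ(n)/2). -/

import Mathlib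

open MeasureTheory Real Filter Set

noncomputable section

/-- The `k`-th Fourier cosine coefficient of a `2π`-periodic function. -/
def fourierA (f : ℝ → ℝ) (k : ℕ) : ℝ := (1 / π) * ∫ t in (-π)..π, f t * Real.cos (k * t)

/-- The `k`-th Fourier sine coefficient of a `2π`-periodic function. -/
def fourierB (f : ℝ → ℝ) (k : ℕ) : ℝ := (1 / π) * ∫ t in (-π)..π, f t * Real.sin (k * t)

/-- The harmonicTerm `A_k(f;x)`. -/
def harmonicTerm (f : ℝ → ℝ) (k : ℕ) (x : ℝ) : ℝ :=
  if k = 0 then fourierA f 0 / 2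
  else fourierA f k * Real.cos (k * x) + fourierB f k * Real.sin (k * x)

/-- `2π`-periodicity. -/
def Periodic2pi (f : ℝ → ℝ) : Prop := ∀ x, f (x + 2 * π) = f x

/-- The set `S_∞`: measurable `2π`-periodic functions essentially bounded by 1. -/
def SInf (φ : ℝ → ℝ) : Prop :=
  Measurable φ ∧ Periodic2pi φ ∧ (∀ᵐ t ∂(volume : Measure ℝ), |φ t| ≤ 1)

/-- `φ` is the `(ψ,β)`-derivative of `f`: `φ ∈ S_∞` and the series
`Σ (1/ψ k)(a_k(f) cos(kx+βπ/2) + b_k(f) sin(kx+βπ/2))` is the Fourier series of `φ`. -/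
def IsPsiDeriv (ψ : ℕ → ℝ) (β : ℝ) (f φ : ℝ → ℝ) : Prop :=
  SInf φ ∧ fourierA φ 0 = 0 ∧
    ∀ k : ℕ, 1 ≤ k →
      fourierA φ k = (1 / ψ k) *
        (fourierA f k * Real.cos (β * π / 2) + fourierB f k * Real.sin (β * π / 2)) ∧
      fourierB φ k = (1 / ψ k) *
        (fourierB f k * Real.cos (β * π / 2) - fourierA f k * Real.sin (β * π / 2))

/-- The class `C^ψ_{β,∞}`. -/
def ClassC (ψ : ℕ → ℝ) (β : ℝ) (f : ℝ → ℝ) : Prop :=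
  Continuous f ∧ Periodic2pi f ∧ ∃ φ, IsPsiDeriv ψ β f φ

/-- Multipliers of the sums `U^ψ_{n,p}` (with `φ(k) = (k-n+p)/ψ(k)`). -/
def lambdaU (ψ : ℕ → ℝ) (n p k : ℕ) : ℝ :=
  if k ≤ n - p then 1
  else 1 - (((k : ℝ) - n + p) / ψ k) / ((p : ℝ) / ψ n)

/-- The sums `U^ψ_{n,p}(f;x)`. -/
def Usum (ψ : ℕ → ℝ) (n p : ℕ) (f : ℝ → ℝ) (x : ℝ) : ℝ :=
  ∑ k ∈ Finset.range n, lambdaU ψ n p k * harmonicTerm f k x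

/-- `E(C^ψ_{β,∞}; T) = sup_{f ∈ C^ψ_{β,∞}} ‖f - T f‖_C`. -/
def classSup (ψ : ℕ → ℝ) (β : ℝ) (T : (ℝ → ℝ) → ℝ → ℝ) : ℝ :=
  sSup {e | ∃ f, ClassC ψ β f ∧ e = ⨆ x : ℝ, |f x - T f x|}

/-- The characteristic `η(ψ;t) = ψ⁻¹(ψ(t)/2)` (inverse taken on `[1,∞)`). -/
def eta (ψ : ℝ → ℝ) (t : ℝ) : ℝ := Function.invFunOn ψ (Set.Ici 1) (ψ t / 2)

/-- The set `M`: positive convex functions on `[1,∞)` vanishing at infinity. -/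
def MClass (ψ : ℝ → ℝ) : Prop :=
  (∀ t ≥ (1 : ℝ), 0 < ψ t) ∧ ConvexOn ℝ (Set.Ici 1) ψ ∧ Tendsto ψ atTop (nhds 0)

/-- The set `F = {ψ ∈ M : η'(ψ;t) ≤ K for all t ≥ 1}`. -/
def FClass (ψ : ℝ → ℝ) : Prop :=
  MClass ψ ∧ ∃ K : ℝ, ∀ t ≥ (1 : ℝ), DifferentiableAt ℝ (eta ψ) t ∧ deriv (eta ψ) t ≤ K

/-! ### Summation by parts -/

theorem one_sub_mul_sum_mul_pow (d : ℕ → ℝ) (z : ℂ) (M : ℕ) :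
    (1 - z) * ∑ j ∈ Finset.range M, (d j : ℂ) * z ^ j =
      d 0 - d M * z ^ M - z * ∑ j ∈ Finset.range M, ((d j - d (j + 1) : ℝ) : ℂ) * z ^ j := by
  induction M with
  | zero => simp
  | succ M ih =>
    rw [Finset.sum_range_succ, mul_add, ih, Finset.sum_range_succ]
    push_cast
    ring

theorem norm_one_sub_mul_sum_le {d : ℕ → ℝ} (hd : Antitone d) (h0 : ∀ j, 0 ≤ d j) {z : ℂ}
    (hz : ‖z‖ = 1) (M : ℕ) :
    ‖(1 - z) * ∑ j ∈ Finset.range M, (d j : ℂ) * z ^ j‖ ≤ 2 * d 0 := by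
  rw [one_sub_mul_sum_mul_pow]
  have h1 : ‖∑ j ∈ Finset.range M, ((d j - d (j + 1) : ℝ) : ℂ) * z ^ j‖ ≤ d 0 - d M := by
    rw [← Finset.sum_range_sub' d M]
    refine norm_sum_le_of_le _ fun j _ => ?_
    rw [norm_mul, norm_pow, hz, one_pow, mul_one, Complex.norm_real, Real.norm_of_nonneg]
    linarith [hd (Nat.le_succ j)]
  calc _ ≤ ‖(d 0 : ℂ)‖ + ‖(d M : ℂ) * z ^ M‖
        + ‖z * ∑ j ∈ Finset.range M, ((d j - d (j + 1) : ℝ) : ℂ) * z ^ j‖ :=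
        (norm_sub_le _ _).trans (by gcongr; exact norm_sub_le _ _)
    _ ≤ d 0 + d M + (d 0 - d M) := by
        rw [norm_mul, norm_mul, norm_pow, hz, one_pow, mul_one, one_mul, Complex.norm_real,
          Complex.norm_real, Real.norm_of_nonneg (h0 0), Real.norm_of_nonneg (h0 M)]
        gcongr
    _ = 2 * d 0 := by ring

theorem norm_sum_sub_div_le {d : ℕ → ℝ} (hd : Antitone d)
    (hc : Antitone fun j => d j - d (j + 1)) {z : ℂ} (hz : ‖z‖ = 1) (hz1 : z ≠ 1) {M : ℕ}
    (hM : d M = 0) :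
    ‖∑ j ∈ Finset.range M, (d j : ℂ) * z ^ j - d 0 / (1 - z)‖
      ≤ 2 * (d 0 - d 1) / ‖1 - z‖ ^ 2 := by
  have hne : (1 - z) ≠ 0 := sub_ne_zero.2 (Ne.symm hz1)
  have hpos : 0 < ‖1 - z‖ := norm_pos_iff.2 hne
  have key : ∑ j ∈ Finset.range M, (d j : ℂ) * z ^ j - d 0 / (1 - z) =
      -(z * ((1 - z) * ∑ j ∈ Finset.range M, ((d j - d (j + 1) : ℝ) : ℂ) * z ^ j))
        / (1 - z) ^ 2 := by
    have h := one_sub_mul_sum_mul_pow d z M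
    rw [hM] at h
    field_simp
    rw [mul_comm, h]
    push_cast
    ring
  rw [key, norm_div, norm_neg, norm_mul, hz, one_mul, norm_pow]
  gcongr
  exact norm_one_sub_mul_sum_le hc (fun j => sub_nonneg.2 (hd (Nat.le_succ j))) hz M

theorem norm_expI (t : ℝ) : ‖Complex.exp (Complex.I * t)‖ = 1 :=
  Complex.norm_exp_I_mul_ofReal t

theorem le_norm_one_sub_expI {t : ℝ} (h0 : 0 ≤ t) (h1 : t ≤ π) :
    2 / π * t ≤ ‖1 - Complex.exp (Complex.I * t)‖ := by
  rw [norm_sub_rev, Complex.norm_exp_I_mul_ofReal_sub_one, norm_mul]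
  have := Real.mul_le_sin (x := t / 2) (by linarith) (by linarith)
  have h2 : Real.sin (t / 2) ≤ ‖Real.sin (t / 2)‖ := Real.le_norm_self _
  have h3 : ‖(2 : ℝ)‖ = 2 := by norm_num
  rw [h3]
  linarith

theorem half_le_norm_one_sub_expI {t : ℝ} (h0 : 0 ≤ t) (h1 : t ≤ π) :
    t / 2 ≤ ‖1 - Complex.exp (Complex.I * t)‖ := by
  refine le_trans ?_ (le_norm_one_sub_expI h0 h1)
  have : (1 : ℝ) / 2 ≤ 2 / π := by
    rw [div_le_div_iff₀ (by norm_num) Real.pi_pos]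
    linarith [Real.pi_le_four]
  nlinarith

theorem expI_ne_one {t : ℝ} (h0 : 0 < t) (h1 : t ≤ π) : Complex.exp (Complex.I * t) ≠ 1 := by
  intro h
  have := half_le_norm_one_sub_expI h0.le h1
  rw [h, sub_self, norm_zero] at this
  linarith

theorem norm_inv_one_sub_expI_sub_le {t : ℝ} (h0 : 0 < t) (h1 : t ≤ π) :
    ‖1 / (1 - Complex.exp (Complex.I * t)) - Complex.I / t‖ ≤ 4 := by
  have hne : (1 - Complex.exp (Complex.I * t)) ≠ 0 := sub_ne_zero.2 (expI_ne_one h0 h1).symm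
  have ht : (t : ℂ) ≠ 0 := by exact_mod_cast h0.ne'
  have hlow := half_le_norm_one_sub_expI h0.le h1
  have hnum : ‖Complex.exp (Complex.I * t) - 1 - Complex.I * t‖ ≤ 2 * t ^ 2 := by
    rcases le_total t 1 with h | h
    · have h2 : ‖Complex.I * (t : ℂ)‖ = t := by
        rw [norm_mul, Complex.norm_I, one_mul, Complex.norm_real, Real.norm_of_nonneg h0.le]
      have := Complex.norm_exp_sub_one_sub_id_le (x := Complex.I * t) (by rw [h2]; exact h)
      rw [h2] at this
      nlinarith
    · have h2 : ‖Complex.I * (t : ℂ)‖ = t := by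
        rw [norm_mul, Complex.norm_I, one_mul, Complex.norm_real, Real.norm_of_nonneg h0.le]
      have h3 : ‖Complex.exp (Complex.I * t) - 1‖ ≤ t :=
        Real.norm_exp_I_mul_ofReal_sub_one_le.trans (Real.norm_of_nonneg h0.le).le
      have := norm_sub_le (Complex.exp (Complex.I * t) - 1) (Complex.I * t)
      nlinarith
  have key : 1 / (1 - Complex.exp (Complex.I * t)) - Complex.I / t =
      Complex.I * (Complex.exp (Complex.I * t) - 1 - Complex.I * t) /
        (t * (1 - Complex.exp (Complex.I * t))) := by
    field_simp
    ring_nf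
    simp
  rw [key, norm_div, norm_mul, norm_mul, Complex.norm_I, one_mul, Complex.norm_real,
    Real.norm_of_nonneg h0.le, div_le_iff₀ (by positivity)]
  nlinarith

theorem norm_sum_expI_le_near {d : ℕ → ℝ} (hd : Antitone d) (h0 : ∀ j, 0 ≤ d j) (M : ℕ) {t : ℝ}
    (ht : 0 < t) (ht1 : t ≤ 1) :
    ‖∑ j ∈ Finset.range M, (d j : ℂ) * Complex.exp (Complex.I * t) ^ j‖ ≤
      10 * ∑ j ∈ Finset.range M, if t ≤ 1 / ((j : ℝ) + 1) then d j else 0 := by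
  set z := Complex.exp (Complex.I * t) with hzdef
  have hz : ‖z‖ = 1 := norm_expI t
  have hterm : ∀ j, ‖(d j : ℂ) * z ^ j‖ = d j := fun j => by
    rw [norm_mul, norm_pow, hz, one_pow, mul_one, Complex.norm_real, Real.norm_of_nonneg (h0 j)]
  set J := ⌊1 / t⌋₊ with hJ
  have hJ1 : (J : ℝ) ≤ 1 / t := Nat.floor_le (by positivity)
  have hJ2 : 1 / t < J + 1 := Nat.lt_floor_add_one _
  have hind : ∀ j, j < J → t ≤ 1 / ((j : ℝ) + 1) := fun j hj => by
    rw [le_div_iff₀ (by positivity), mul_comm, ← le_div_iff₀ ht]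
    refine le_trans ?_ hJ1
    exact_mod_cast hj
  have hsum0 : ∀ m, 0 ≤ ∑ j ∈ Finset.range m, if t ≤ 1 / ((j : ℝ) + 1) then d j else 0 :=
    fun m => Finset.sum_nonneg fun j _ => by split_ifs <;> simp [h0 j]
  have hfirst : ∀ m, m ≤ J → ‖∑ j ∈ Finset.range m, (d j : ℂ) * z ^ j‖ ≤
      ∑ j ∈ Finset.range m, if t ≤ 1 / ((j : ℝ) + 1) then d j else 0 := fun m hm => by
    refine norm_sum_le_of_le _ fun j hj => ?_
    rw [if_pos (hind j ((Finset.mem_range.1 hj).trans_le hm)), hterm]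
  rcases le_total M J with hMJ | hMJ
  · linarith [hfirst M hMJ, hsum0 M]
  obtain ⟨r, rfl⟩ := Nat.exists_eq_add_of_le hMJ
  have hmono : (∑ j ∈ Finset.range J, if t ≤ 1 / ((j : ℝ) + 1) then d j else 0) ≤
      ∑ j ∈ Finset.range (J + r), if t ≤ 1 / ((j : ℝ) + 1) then d j else 0 := by
    refine Finset.sum_le_sum_of_subset_of_nonneg (by simp) fun j _ _ => ?_
    split_ifs <;> simp [h0 j]
  have htail : ‖∑ i ∈ Finset.range r, (d (J + i) : ℂ) * z ^ (J + i)‖ ≤ 4 * d J / t := by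
    have h1 : ∑ i ∈ Finset.range r, (d (J + i) : ℂ) * z ^ (J + i) =
        z ^ J * ∑ i ∈ Finset.range r, (d (J + i) : ℂ) * z ^ i := by
      rw [Finset.mul_sum]
      exact Finset.sum_congr rfl fun i _ => by ring
    have h2 := norm_one_sub_mul_sum_le (d := fun i => d (J + i))
      (fun a b hab => hd (by omega)) (fun i => h0 _) hz r
    rw [norm_mul] at h2
    have h3 := half_le_norm_one_sub_expI ht.le (ht1.trans (by linarith [Real.pi_gt_three]))
    rw [h1, norm_mul, norm_pow, hz, one_pow, one_mul, le_div_iff₀ ht]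
    simp only [add_zero] at h2
    nlinarith [norm_nonneg (∑ i ∈ Finset.range r, (d (J + i) : ℂ) * z ^ i)]
  have hJpos : (1 : ℝ) ≤ J := by
    have : 1 ≤ J := Nat.le_floor (by rw [Nat.cast_one, le_div_iff₀ ht]; linarith)
    exact_mod_cast this
  have hdJ : d J / t ≤ 2 * ∑ j ∈ Finset.range J, if t ≤ 1 / ((j : ℝ) + 1) then d j else 0 := by
    have h1 : (J : ℝ) * d J ≤ ∑ j ∈ Finset.range J, if t ≤ 1 / ((j : ℝ) + 1) then d j else 0 := by
      rw [← nsmul_eq_mul]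
      conv_lhs => rw [← Finset.card_range J]
      refine Finset.card_nsmul_le_sum _ _ _ fun j hj => ?_
      have hj' := Finset.mem_range.1 hj
      rw [if_pos (hind j hj')]
      simpa using hd hj'.le
    have h2 : d J / t = d J * (1 / t) := by ring
    rw [h2]
    nlinarith [h0 J]
  rw [Finset.sum_range_add]
  have h5 : 4 * d J / t = 4 * (d J / t) := by ring
  calc _ ≤ _ := norm_add_le _ _
    _ ≤ (∑ j ∈ Finset.range J, if t ≤ 1 / ((j : ℝ) + 1) then d j else 0) + 4 * d J / t :=
      add_le_add (hfirst J le_rfl) htail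
    _ ≤ _ := by rw [h5]; linarith [hsum0 J]

/-! ### Linear ramps -/

theorem one_sub_mul_sum_nat_mul_pow (z : ℂ) (p : ℕ) :
    (1 - z) * ((1 - z) * ∑ j ∈ Finset.range p, (j : ℂ) * z ^ j + p * z ^ p) = z - z ^ (p + 1) := by
  induction p with
  | zero => simp
  | succ p ih =>
    rw [Finset.sum_range_succ]
    push_cast
    linear_combination ih

theorem norm_ramp_le {z : ℂ} (hz : ‖z‖ = 1) (p : ℕ) :
    ‖∑ j ∈ Finset.range p, (((j : ℝ) / p : ℝ) : ℂ) * z ^ j‖ ≤ p := by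
  calc _ ≤ ∑ j ∈ Finset.range p, (1 : ℝ) := by
        refine norm_sum_le_of_le _ fun j hj => ?_
        rw [norm_mul, norm_pow, hz, one_pow, mul_one, Complex.norm_real,
          Real.norm_of_nonneg (by positivity)]
        refine div_le_one_of_le₀ ?_ (by positivity)
        exact_mod_cast (Finset.mem_range.1 hj).le
    _ = p := by simp

theorem norm_ramp_add_le {z : ℂ} (hz : ‖z‖ = 1) (hz1 : z ≠ 1) {p : ℕ} (hp : 1 ≤ p) :
    ‖∑ j ∈ Finset.range p, (((j : ℝ) / p : ℝ) : ℂ) * z ^ j + z ^ p / (1 - z)‖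
      ≤ 2 / (p * ‖1 - z‖ ^ 2) := by
  have hne : (1 - z) ≠ 0 := sub_ne_zero.2 (Ne.symm hz1)
  have hpos : 0 < ‖1 - z‖ := norm_pos_iff.2 hne
  have hp0 : (p : ℂ) ≠ 0 := by exact_mod_cast (by omega : p ≠ 0)
  have key : ∑ j ∈ Finset.range p, (((j : ℝ) / p : ℝ) : ℂ) * z ^ j + z ^ p / (1 - z) =
      (z - z ^ (p + 1)) / (p * (1 - z) ^ 2) := by
    have h : ∑ j ∈ Finset.range p, (((j : ℝ) / p : ℝ) : ℂ) * z ^ j =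
        (∑ j ∈ Finset.range p, (j : ℂ) * z ^ j) / p := by
      rw [Finset.sum_div]
      exact Finset.sum_congr rfl fun j _ => by push_cast; ring
    rw [h, ← one_sub_mul_sum_nat_mul_pow]
    field_simp
  rw [key, norm_div, norm_mul, norm_pow, Complex.norm_natCast]
  gcongr
  calc _ ≤ _ := norm_sub_le _ _
    _ = 2 := by rw [norm_pow, hz]; norm_num

/-! ### `L¹` comparison with the model kernels -/

theorem intervalIntegrable_of_measurable_of_norm_le {E : Type*} [NormedAddCommGroup E]
    [MeasurableSpace E] [BorelSpace E] [SecondCountableTopology E] {F : ℝ → E}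
    (hF : Measurable F) {C : ℝ} (hC : ∀ t, ‖F t‖ ≤ C) (a b : ℝ) :
    IntervalIntegrable F volume a b :=
  (intervalIntegrable_const (c := C)).mono_fun hF.aestronglyMeasurable
    (Eventually.of_forall fun t => (hC t).trans (Real.le_norm_self C))

theorem integral_le_of_le_on_split {F G : ℝ → ℝ} (hF : IntervalIntegrable F volume 0 π) {a A D : ℝ}
    (ha : 0 < a) (ha1 : a ≤ 1) (hG : IntervalIntegrable G volume 0 a)
    (hA : 0 ≤ A) (hD : 0 ≤ D) (h1 : ∀ t, 0 < t → t ≤ a → F t ≤ G t)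
    (h2 : ∀ t, a < t → t ≤ π → F t ≤ A / t ^ 2 + D) :
    ∫ t in (0 : ℝ)..π, F t ≤ (∫ t in (0 : ℝ)..a, G t) + A / a + 4 * D := by
  have hπ : a ≤ π := ha1.trans (by linarith [Real.pi_gt_three])
  have hFa : IntervalIntegrable F volume 0 a := hF.mono_set (by
    rw [uIcc_of_le ha.le, uIcc_of_le Real.pi_pos.le]; exact Icc_subset_Icc_right hπ)
  have hFb : IntervalIntegrable F volume a π := hF.mono_set (by
    rw [uIcc_of_le hπ, uIcc_of_le Real.pi_pos.le]; exact Icc_subset_Icc_left ha.le)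
  have hderiv : ∀ t ∈ uIcc a π, HasDerivAt (fun t => -A / t + D * t) (A / t ^ 2 + D) t := by
    intro t ht
    rw [uIcc_of_le hπ] at ht
    have ht0 : t ≠ 0 := (ha.trans_le ht.1).ne'
    have := ((hasDerivAt_inv ht0).const_mul (-A)).add ((hasDerivAt_id t).const_mul D)
    refine (this.congr_of_eventuallyEq (Eventually.of_forall fun x => ?_)).congr_deriv ?_
    · simp [div_eq_mul_inv]
    · simp [div_eq_mul_inv]
  have hcont : ContinuousOn (fun t : ℝ => A / t ^ 2 + D) (uIcc a π) := by
    rw [uIcc_of_le hπ]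
    refine ContinuousOn.add (ContinuousOn.div continuousOn_const (by fun_prop) ?_)
      continuousOn_const
    intro t ht
    exact pow_ne_zero _ (ha.trans_le ht.1).ne'
  have hint := intervalIntegral.integral_eq_sub_of_hasDerivAt hderiv hcont.intervalIntegrable
  rw [← intervalIntegral.integral_add_adjacent_intervals hFa hFb]
  have i1 : ∫ t in (0 : ℝ)..a, F t ≤ ∫ t in (0 : ℝ)..a, G t :=
    intervalIntegral.integral_mono_on_of_le_Ioo ha.le hFa hG fun t ht => h1 t ht.1 ht.2.le
  have i2 : ∫ t in a..π, F t ≤ ∫ t in a..π, (A / t ^ 2 + D) :=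
    intervalIntegral.integral_mono_on_of_le_Ioo hπ hFb hcont.intervalIntegrable
      fun t ht => h2 t ht.1 ht.2.le
  have i3 : 0 ≤ A / π := div_nonneg hA Real.pi_pos.le
  have i4 : D * π ≤ 4 * D := by nlinarith [Real.pi_le_four]
  have i5 : 0 ≤ D * a := by positivity
  rw [hint] at i2
  have i6 : -A / a = -(A / a) := by ring
  have i7 : -A / π = -(A / π) := by ring
  linarith

theorem integral_ite_le_const {a b c : ℝ} (ha : 0 ≤ a) (hb : 0 ≤ b) :
    ∫ t in (0 : ℝ)..a, (if t ≤ b then c else 0) = c * min a b := by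
  have hmin : ∀ t ∈ uIcc 0 a, (if t ≤ b then c else 0)
      = indicator {x | x ≤ min a b} (fun _ => c) t := by
    intro t ht
    rw [uIcc_of_le ha] at ht
    simp only [indicator, mem_ofPred_eq, le_min_iff, ht.2, true_and]
  rw [intervalIntegral.integral_congr hmin,
    intervalIntegral.integral_indicator ⟨le_min ha hb, min_le_left _ _⟩]
  simp [mul_comm]

theorem measurable_model (a D : ℝ) :
    Measurable fun t : ℝ => if a < t then (D : ℂ) * (Complex.I / t) else 0 :=
  Measurable.ite measurableSet_Ioi (by fun_prop) measurable_const

theorem norm_model_le {a D : ℝ} (ha : 0 < a) (hD : 0 ≤ D) (t : ℝ) :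
    ‖if a < t then (D : ℂ) * (Complex.I / t) else 0‖ ≤ D / a := by
  split_ifs with h
  · have ht : 0 < t := ha.trans h
    rw [norm_mul, norm_div, Complex.norm_I, Complex.norm_real, Complex.norm_real,
      Real.norm_of_nonneg hD, Real.norm_of_nonneg ht.le, mul_one_div]
    gcongr
  · simp only [norm_zero]; positivity

theorem norm_sum_expI_le (d : ℕ → ℝ) (M : ℕ) (t : ℝ) :
    ‖∑ j ∈ Finset.range M, (d j : ℂ) * Complex.exp (Complex.I * t) ^ j‖ ≤
      ∑ j ∈ Finset.range M, |d j| := by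
  refine norm_sum_le_of_le _ fun j _ => ?_
  rw [norm_mul, norm_pow, norm_expI, one_pow, mul_one, Complex.norm_real, Real.norm_eq_abs]

theorem measurable_sum_expI (d : ℕ → ℝ) (M : ℕ) :
    Measurable fun t : ℝ => ∑ j ∈ Finset.range M, (d j : ℂ) * Complex.exp (Complex.I * t) ^ j := by
  fun_prop

/-- A convex decreasing cosine-type tail is `L¹`-close to the model kernel `D·i/t` on
`t > 1/q`. -/
theorem integral_tail_sub_model_le {d : ℕ → ℝ} (hd : Antitone d) (h0 : ∀ j, 0 ≤ d j)
    (hc : Antitone fun j => d j - d (j + 1)) {M : ℕ} (hM : d M = 0) {q D A : ℝ} (hq : 1 ≤ q)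
    (hD : 0 ≤ D) (hA : 0 ≤ A) (hdD : d 0 ≤ D) (hDd : D - d 0 ≤ D / q)
    (hd1 : d 0 - d 1 ≤ A * D / q)
    (hB : ∑ j ∈ Finset.range M, d j * min (1 / q) (1 / ((j : ℝ) + 1)) ≤ A * D) :
    ∫ t in (0 : ℝ)..π, ‖∑ j ∈ Finset.range M, (d j : ℂ) * Complex.exp (Complex.I * t) ^ j
      - (if 1 / q < t then (D : ℂ) * (Complex.I / t) else 0)‖ ≤ (18 * A + 24) * D := by
  have hq0 : 0 < q := by linarith
  have hite : ∀ j : ℕ, IntervalIntegrable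
      (fun t : ℝ => if t ≤ 1 / ((j : ℝ) + 1) then d j else 0) volume 0 (1 / q) := fun j =>
    intervalIntegrable_of_measurable_of_norm_le (C := |d j|)
      (Measurable.ite measurableSet_Iic measurable_const measurable_const)
      (fun t => by split_ifs <;> simp) _ _
  have hG : IntervalIntegrable (fun t : ℝ => 10 * ∑ j ∈ Finset.range M,
      if t ≤ 1 / ((j : ℝ) + 1) then d j else 0) volume 0 (1 / q) := by
    refine IntervalIntegrable.const_mul ?_ 10
    have := IntervalIntegrable.sum (Finset.range M) (f := fun (j : ℕ) (t : ℝ) =>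
      if t ≤ 1 / ((j : ℝ) + 1) then d j else 0) (fun j _ => hite j)
    rwa [show (fun t : ℝ => ∑ j ∈ Finset.range M, if t ≤ 1 / ((j : ℝ) + 1) then d j else 0) =
      ∑ j ∈ Finset.range M, fun t : ℝ => if t ≤ 1 / ((j : ℝ) + 1) then d j else 0 from by
        funext t; simp only [Finset.sum_apply]]
  have key := integral_le_of_le_on_split (F := fun t : ℝ =>
      ‖∑ j ∈ Finset.range M, (d j : ℂ) * Complex.exp (Complex.I * t) ^ j
      - (if 1 / q < t then (D : ℂ) * (Complex.I / t) else 0)‖)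
      (a := 1 / q) (A := 8 * (A * D / q)) (D := 6 * D) ?_
      (by positivity) ((div_le_one hq0).2 hq) hG (by positivity) (by positivity) ?_ ?_
  · refine key.trans ?_
    have hsum : ∫ t in (0 : ℝ)..1 / q, (10 * ∑ j ∈ Finset.range M,
        if t ≤ 1 / ((j : ℝ) + 1) then d j else 0) ≤ 10 * (A * D) := by
      rw [intervalIntegral.integral_const_mul,
        intervalIntegral.integral_finsetSum fun j _ => hite j]
      refine mul_le_mul_of_nonneg_left (le_trans (le_of_eq ?_) hB) (by norm_num)
      refine Finset.sum_congr rfl fun j _ => ?_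
      rw [integral_ite_le_const (by positivity) (by positivity)]
    have : 8 * (A * D / q) / (1 / q) = 8 * (A * D) := by field_simp
    rw [this]
    nlinarith
  · refine intervalIntegrable_of_measurable_of_norm_le
      ((measurable_sum_expI d M).sub (measurable_model _ _)).norm
      (C := ∑ j ∈ Finset.range M, |d j| + D / (1 / q)) (fun t => ?_) _ _
    rw [norm_norm]
    exact (norm_sub_le _ _).trans
      (add_le_add (norm_sum_expI_le d M t) (norm_model_le (by positivity) hD t))
  · intro t ht hta
    simp only [if_neg (not_lt.2 hta), sub_zero]
    exact norm_sum_expI_le_near hd h0 M ht (hta.trans ((div_le_one hq0).2 hq))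
  · intro t hta htπ
    have ht : 0 < t := lt_trans (by positivity) hta
    simp only [if_pos hta]
    set z := Complex.exp (Complex.I * t)
    have hlow : t / 2 ≤ ‖1 - z‖ := half_le_norm_one_sub_expI ht.le htπ
    have hdec : ∑ j ∈ Finset.range M, (d j : ℂ) * z ^ j - (D : ℂ) * (Complex.I / t) =
        (∑ j ∈ Finset.range M, (d j : ℂ) * z ^ j - d 0 / (1 - z)) - ((D - d 0 : ℝ) : ℂ) / (1 - z)
          + D * (1 / (1 - z) - Complex.I / t) := by
      push_cast; ring
    rw [hdec]
    have e1 : ‖∑ j ∈ Finset.range M, (d j : ℂ) * z ^ j - d 0 / (1 - z)‖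
        ≤ 8 * (A * D / q) / t ^ 2 := by
      refine (norm_sum_sub_div_le hd hc (norm_expI t) (expI_ne_one ht htπ) hM).trans ?_
      calc _ ≤ 2 * (A * D / q) / (t / 2) ^ 2 := by gcongr
        _ = _ := by field_simp; ring
    have e2 : ‖((D - d 0 : ℝ) : ℂ) / (1 - z)‖ ≤ 2 * D := by
      rw [norm_div, Complex.norm_real, Real.norm_of_nonneg (by linarith)]
      have hqt : 1 < t * q := by rwa [div_lt_iff₀ hq0] at hta
      calc _ ≤ (D / q) / (t / 2) := by gcongr
        _ = 2 * D * (1 / (t * q)) := by field_simp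
        _ ≤ 2 * D * 1 := by
          gcongr
          rw [div_le_one (by positivity)]; exact hqt.le
        _ = 2 * D := by ring
    have e3 : ‖(D : ℂ) * (1 / (1 - z) - Complex.I / t)‖ ≤ 4 * D := by
      rw [norm_mul, Complex.norm_real, Real.norm_of_nonneg hD]
      nlinarith [norm_inv_one_sub_expI_sub_le ht htπ]
    calc _ ≤ _ := norm_add_le _ _
      _ ≤ _ := add_le_add (norm_sub_le _ _) le_rfl
      _ ≤ 8 * (A * D / q) / t ^ 2 + 2 * D + 4 * D := by gcongr
      _ = _ := by ring

/-- A linear ramp of length `p` is `L¹`-close to the model kernel `-i e^{ipt}/t` on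
`t > 1/p`. -/
theorem integral_ramp_add_model_le {p : ℕ} (hp : 1 ≤ p) :
    ∫ t in (0 : ℝ)..π, ‖∑ j ∈ Finset.range p,
        (((j : ℝ) / p : ℝ) : ℂ) * Complex.exp (Complex.I * t) ^ j
      + Complex.exp (Complex.I * t) ^ p *
        (if 1 / (p : ℝ) < t then ((1 : ℝ) : ℂ) * (Complex.I / t) else 0)‖ ≤ 25 := by
  have hp0 : (0 : ℝ) < p := by exact_mod_cast hp
  have hp1 : (1 : ℝ) ≤ p := by exact_mod_cast hp
  have key := integral_le_of_le_on_split (F := fun t : ℝ => ‖∑ j ∈ Finset.range p,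
        (((j : ℝ) / p : ℝ) : ℂ) * Complex.exp (Complex.I * t) ^ j
      + Complex.exp (Complex.I * t) ^ p *
        (if 1 / (p : ℝ) < t then ((1 : ℝ) : ℂ) * (Complex.I / t) else 0)‖)
      (G := fun _ => (p : ℝ))
      (a := 1 / p) (A := 8 / p) (D := 4) ?_
      (by positivity) ((div_le_one hp0).2 hp1) intervalIntegrable_const (by positivity)
      (by positivity) ?_ ?_
  · refine key.trans ?_
    rw [intervalIntegral.integral_const, smul_eq_mul]
    field_simp
    norm_num
  · refine intervalIntegrable_of_measurable_of_norm_le (Measurable.norm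
      ((measurable_sum_expI (fun j => (j : ℝ) / p) p).add
        (Measurable.mul (by fun_prop) (measurable_model _ _))))
      (C := ∑ j ∈ Finset.range p, |(j : ℝ) / p| + 1 / (1 / (p : ℝ))) (fun t => ?_) _ _
    rw [norm_norm]
    refine (norm_add_le _ _).trans
      (add_le_add (norm_sum_expI_le (fun j => (j : ℝ) / p) p t) ?_)
    rw [Pi.mul_apply, norm_mul, norm_pow, norm_expI, one_pow, one_mul]
    exact norm_model_le (by positivity) zero_le_one t
  · intro t ht hta
    simp only [if_neg (not_lt.2 hta), mul_zero, add_zero]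
    exact norm_ramp_le (norm_expI t) p
  · intro t hta htπ
    have ht : 0 < t := lt_trans (by positivity) hta
    simp only [if_pos hta]
    set z := Complex.exp (Complex.I * t)
    have hlow : t / 2 ≤ ‖1 - z‖ := half_le_norm_one_sub_expI ht.le htπ
    have hdec : ∑ j ∈ Finset.range p, (((j : ℝ) / p : ℝ) : ℂ) * z ^ j
          + z ^ p * (((1 : ℝ) : ℂ) * (Complex.I / t)) =
        (∑ j ∈ Finset.range p, (((j : ℝ) / p : ℝ) : ℂ) * z ^ j + z ^ p / (1 - z))
          - z ^ p * (1 / (1 - z) - Complex.I / t) := by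
      push_cast; ring
    rw [hdec]
    have e1 := norm_ramp_add_le (norm_expI t) (expI_ne_one ht htπ) hp
    have e2 : 2 / (p * ‖1 - z‖ ^ 2) ≤ 8 / p / t ^ 2 := by
      calc _ ≤ 2 / (p * (t / 2) ^ 2) := by gcongr
        _ = _ := by field_simp; ring
    have e3 : ‖z ^ p * (1 / (1 - z) - Complex.I / t)‖ ≤ 4 := by
      rw [norm_mul, norm_pow, norm_expI, one_pow, one_mul]
      exact norm_inv_one_sub_expI_sub_le ht htπ
    calc _ ≤ _ := norm_sub_le _ _
      _ ≤ _ := add_le_add (e1.trans e2) e3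

/-! ### The kernel of the deviation -/

/-- The Fejér multipliers. -/
def fejerWeight (N k : ℕ) : ℝ := max 0 (1 - (k : ℝ) / N)

theorem fejerWeight_nonneg (N k : ℕ) : 0 ≤ fejerWeight N k := le_max_left _ _

theorem fejerWeight_le_one (N k : ℕ) : fejerWeight N k ≤ 1 :=
  max_le zero_le_one (by linarith [show 0 ≤ (k : ℝ) / N by positivity])

theorem fejerWeight_of_le {N k : ℕ} (h : k ≤ N) : fejerWeight N k = 1 - (k : ℝ) / N :=
  max_eq_right (sub_nonneg.2 (div_le_one_of_le₀ (by exact_mod_cast h) N.cast_nonneg))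

theorem fejerWeight_of_ge {N k : ℕ} (hN : 0 < N) (h : N ≤ k) : fejerWeight N k = 0 :=
  max_eq_left (sub_nonpos.2 ((one_le_div (by exact_mod_cast hN)).2 (by exact_mod_cast h)))

theorem fejerWeight_antitone (N : ℕ) : Antitone (fejerWeight N) := fun a b h =>
  max_le_max le_rfl (by gcongr)

theorem fejerWeight_sub_succ {N : ℕ} (hN : 0 < N) (k : ℕ) :
    fejerWeight N k - fejerWeight N (k + 1) = if k < N then 1 / (N : ℝ) else 0 := by
  split_ifs with h
  · rw [fejerWeight_of_le h.le, fejerWeight_of_le h]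
    push_cast
    ring
  · rw [fejerWeight_of_ge hN (by omega), fejerWeight_of_ge hN (by omega), sub_zero]

theorem fejerWeight_convex {N : ℕ} (hN : 0 < N) :
    Antitone fun k => fejerWeight N k - fejerWeight N (k + 1) := by
  intro a b hab
  simp only [fejerWeight_sub_succ hN]
  split_ifs with h1 h2 h2
  · exact le_rfl
  · omega
  · positivity
  · exact le_rfl

theorem antitone_mul_of_nonneg {f g : ℕ → ℝ} (hf : Antitone f) (hg : Antitone g)
    (f0 : ∀ j, 0 ≤ f j) (g0 : ∀ j, 0 ≤ g j) : Antitone fun j => f j * g j :=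
  fun _ b h => mul_le_mul (hf h) (hg h) (g0 b) (f0 _)

theorem antitone_mul_sub_succ {f g : ℕ → ℝ} (hf : Antitone f) (hg : Antitone g)
    (f0 : ∀ j, 0 ≤ f j) (g0 : ∀ j, 0 ≤ g j) (fc : Antitone fun j => f j - f (j + 1))
    (gc : Antitone fun j => g j - g (j + 1)) :
    Antitone fun j => f j * g j - f (j + 1) * g (j + 1) := by
  have h : (fun j => f j * g j - f (j + 1) * g (j + 1)) =
      fun j => f j * (g j - g (j + 1)) + g (j + 1) * (f j - f (j + 1)) := by
    funext j; ring
  rw [h]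
  exact (antitone_mul_of_nonneg hf gc f0 fun j => sub_nonneg.2 (hg (Nat.le_succ j))).add
    (antitone_mul_of_nonneg (fun a b hab => hg (by omega)) fc (fun j => g0 _)
      fun j => sub_nonneg.2 (hf (Nat.le_succ j)))

/-- The Fourier multipliers of the kernel of `f - U_{n,p} f`. -/
def devCoef (ψ : ℕ → ℝ) (n p k : ℕ) : ℝ :=
  if k < n then ((k - (n - p) : ℕ) : ℝ) / p * ψ n else ψ k

/-- Fejér means of the kernel of `f - U_{n,p} f`. -/
def devKernel (ψ : ℕ → ℝ) (n p N : ℕ) (θ t : ℝ) : ℝ :=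
  ∑ k ∈ Finset.range N, fejerWeight N k * devCoef ψ n p k * Real.cos (k * t + θ)

/-- The principal part of the kernel of `f - U_{n,p} f`. -/
def modelKernel (D : ℝ) (n p : ℕ) (q θ t : ℝ) : ℝ :=
  D * ((if 1 / (p : ℝ) < |t| then 1 else 0) - (if 1 / q < |t| then 1 else 0)) *
    (Real.sin (n * t + θ) / t)

/-- Quantitative regularity of the tail `ψ n, ψ (n+1), …` at the scale `q`. -/
structure RegularTail (ψ : ℕ → ℝ) (n : ℕ) (q A : ℝ) : Prop where
  one_le : 1 ≤ q
  nonneg : ∀ j, 0 ≤ ψ (n + j)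
  antitone : Antitone fun j => ψ (n + j)
  convex : Antitone fun j => ψ (n + j) - ψ (n + (j + 1))
  step : ψ n - ψ (n + 1) ≤ A * ψ n / q
  sum_le : ∀ M, ∑ j ∈ Finset.range M, ψ (n + j) * min (1 / q) (1 / ((j : ℝ) + 1)) ≤ A * ψ n

theorem RegularTail.const_nonneg {ψ : ℕ → ℝ} {n : ℕ} {q A : ℝ} (h : RegularTail ψ n q A)
    (hpos : 0 < ψ n) : 0 ≤ A := by
  have h1 := h.sum_le 0
  simp only [Finset.range_zero, Finset.sum_empty] at h1
  exact nonneg_of_mul_nonneg_left h1 hpos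

theorem sum_devCoef_mul_pow {ψ : ℕ → ℝ} {n p : ℕ} (hpn : p ≤ n) (z : ℂ) :
    ∑ k ∈ Finset.range n, (devCoef ψ n p k : ℂ) * z ^ k =
      ψ n * z ^ (n - p) * ∑ j ∈ Finset.range p, (((j : ℝ) / p : ℝ) : ℂ) * z ^ j := by
  obtain ⟨m, rfl⟩ := Nat.exists_eq_add_of_le' hpn
  rw [Finset.sum_range_add, Finset.sum_eq_zero, zero_add, Finset.mul_sum]
  · refine Finset.sum_congr rfl fun j hj => ?_
    have hj' := Finset.mem_range.1 hj
    rw [devCoef, if_pos (by omega), show m + j - (m + p - p) = j by omega,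
      show m + p - p = m by omega]
    push_cast
    ring
  · intro k hk
    have hk' := Finset.mem_range.1 hk
    rw [devCoef, if_pos (by omega), show k - (m + p - p) = 0 by omega]
    simp

theorem devCoef_mem_Icc {ψ : ℕ → ℝ} {n p k : ℕ} (hD : 0 ≤ ψ n) (hk : k < n) :
    0 ≤ devCoef ψ n p k ∧ devCoef ψ n p k ≤ ψ n := by
  rw [devCoef, if_pos hk]
  refine ⟨by positivity, mul_le_of_le_one_left hD (div_le_one_of_le₀ ?_ p.cast_nonneg)⟩
  exact_mod_cast (by omega : k - (n - p) ≤ p)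

theorem cos_eq_re_expI (k : ℕ) (t θ : ℝ) :
    Real.cos (k * t + θ) =
      (Complex.exp (Complex.I * θ) * Complex.exp (Complex.I * t) ^ k).re := by
  rw [← Complex.exp_nat_mul, ← Complex.exp_add,
    show Complex.I * (θ : ℂ) + k * (Complex.I * t) = ((k * t + θ : ℝ) : ℂ) * Complex.I by
      push_cast; ring, Complex.exp_ofReal_mul_I_re]

theorem re_model (n : ℕ) (t θ D : ℝ) :
    (Complex.exp (Complex.I * θ) * (Complex.exp (Complex.I * t) ^ n *
      ((D : ℂ) * (Complex.I / t)))).re = -(D * (Real.sin (n * t + θ) / t)) := by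
  have h : Complex.exp (Complex.I * θ) * (Complex.exp (Complex.I * t) ^ n *
      ((D : ℂ) * (Complex.I / t))) =
      ((D / t : ℝ) : ℂ) * (Complex.I * Complex.exp (((n * t + θ : ℝ) : ℂ) * Complex.I)) := by
    rw [show ((n * t + θ : ℝ) : ℂ) * Complex.I = Complex.I * (θ : ℂ) + n * (Complex.I * t) by
      push_cast; ring, Complex.exp_add, Complex.exp_nat_mul]
    push_cast
    ring
  rw [h, Complex.re_ofReal_mul, Complex.I_mul_re, Complex.exp_ofReal_mul_I_im]
  ring

theorem devKernel_eq_re (ψ : ℕ → ℝ) (n p N : ℕ) (θ t : ℝ) :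
    devKernel ψ n p N θ t = (Complex.exp (Complex.I * θ) * ∑ k ∈ Finset.range N,
      ((fejerWeight N k * devCoef ψ n p k : ℝ) : ℂ) * Complex.exp (Complex.I * t) ^ k).re := by
  rw [devKernel, Finset.mul_sum, Complex.re_sum]
  refine Finset.sum_congr rfl fun k _ => ?_
  rw [mul_left_comm, Complex.re_ofReal_mul, cos_eq_re_expI]

theorem modelKernel_eq_re (D : ℝ) {n p : ℕ} (hpn : p ≤ n) (q θ t : ℝ) (ht : 0 < t) :
    modelKernel D n p q θ t = (Complex.exp (Complex.I * θ) * (Complex.exp (Complex.I * t) ^ n *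
        (if 1 / q < t then (D : ℂ) * (Complex.I / t) else 0)
      - D * Complex.exp (Complex.I * t) ^ (n - p) * (Complex.exp (Complex.I * t) ^ p *
        (if 1 / (p : ℝ) < t then ((1 : ℝ) : ℂ) * (Complex.I / t) else 0)))).re := by
  have h1 : (D : ℂ) * Complex.exp (Complex.I * t) ^ (n - p) * (Complex.exp (Complex.I * t) ^ p *
        (if 1 / (p : ℝ) < t then ((1 : ℝ) : ℂ) * (Complex.I / t) else 0)) =
      Complex.exp (Complex.I * t) ^ n *
        (if 1 / (p : ℝ) < t then (D : ℂ) * (Complex.I / t) else 0) := by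
    rw [← Nat.sub_add_cancel hpn, pow_add, Nat.add_sub_cancel]
    split_ifs
    · push_cast; ring
    · simp
  rw [h1, mul_sub, Complex.sub_re, modelKernel, abs_of_pos ht]
  split_ifs <;> simp only [re_model, mul_zero, Complex.zero_re] <;> ring

theorem abs_devKernel_sub_modelKernel_le {ψ : ℕ → ℝ} {n p N : ℕ} (hpn : p ≤ n) (hD : 0 ≤ ψ n)
    (hN : n ^ 2 ≤ N) (hnN : n ≤ N) (hN0 : 0 < N) (q θ : ℝ) {t : ℝ} (ht : 0 < t) :
    |devKernel ψ n p N θ t - modelKernel (ψ n) n p q θ t| ≤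
      ψ n * ‖∑ j ∈ Finset.range p, (((j : ℝ) / p : ℝ) : ℂ) * Complex.exp (Complex.I * t) ^ j
        + Complex.exp (Complex.I * t) ^ p *
          (if 1 / (p : ℝ) < t then ((1 : ℝ) : ℂ) * (Complex.I / t) else 0)‖
      + ‖∑ j ∈ Finset.range (N - n), ((fejerWeight N (n + j) * ψ (n + j) : ℝ) : ℂ) *
          Complex.exp (Complex.I * t) ^ j
        - (if 1 / q < t then (ψ n : ℂ) * (Complex.I / t) else 0)‖ + ψ n := by
  rw [devKernel_eq_re, modelKernel_eq_re _ hpn _ _ _ ht, ← Complex.sub_re, ← mul_sub]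
  refine (Complex.abs_re_le_norm _).trans ?_
  rw [norm_mul, norm_expI, one_mul]
  have hz := norm_expI t
  generalize Complex.exp (Complex.I * (t : ℂ)) = z at hz ⊢
  generalize (if 1 / (p : ℝ) < t then ((1 : ℝ) : ℂ) * (Complex.I / t) else 0) = mp
  generalize (if 1 / q < t then (ψ n : ℂ) * (Complex.I / t) else 0) = mq
  have hsplit : ∑ k ∈ Finset.range N, ((fejerWeight N k * devCoef ψ n p k : ℝ) : ℂ) * z ^ k =
      ∑ k ∈ Finset.range n, (devCoef ψ n p k : ℂ) * z ^ k
      - ∑ k ∈ Finset.range n, (((k : ℝ) / N * devCoef ψ n p k : ℝ) : ℂ) * z ^ k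
      + z ^ n * ∑ j ∈ Finset.range (N - n),
        ((fejerWeight N (n + j) * ψ (n + j) : ℝ) : ℂ) * z ^ j := by
    conv_lhs => rw [← Nat.add_sub_cancel' hnN, Finset.sum_range_add]
    rw [Nat.add_sub_cancel' hnN, ← Finset.sum_sub_distrib, Finset.mul_sum]
    congr 1
    · refine Finset.sum_congr rfl fun k hk => ?_
      rw [fejerWeight_of_le ((Finset.mem_range.1 hk).le.trans hnN)]
      push_cast
      ring
    · refine Finset.sum_congr rfl fun j _ => ?_
      rw [devCoef, if_neg (by omega)]
      ring
  have herr : ‖∑ k ∈ Finset.range n, (((k : ℝ) / N * devCoef ψ n p k : ℝ) : ℂ) * z ^ k‖ ≤ ψ n := by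
    have hNpos : (0 : ℝ) < N := by exact_mod_cast hN0
    calc _ ≤ ∑ k ∈ Finset.range n, (n : ℝ) / N * ψ n := by
          refine norm_sum_le_of_le _ fun k hk => ?_
          have hk' := Finset.mem_range.1 hk
          have hk'' : (k : ℝ) ≤ n := by exact_mod_cast hk'.le
          obtain ⟨h1, h2⟩ := devCoef_mem_Icc (ψ := ψ) (p := p) hD hk'
          rw [norm_mul, norm_pow, hz, one_pow, mul_one, Complex.norm_real,
            Real.norm_of_nonneg (by positivity)]
          gcongr
      _ = (n : ℝ) ^ 2 / N * ψ n := by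
          rw [Finset.sum_const, Finset.card_range, nsmul_eq_mul]; ring
      _ ≤ 1 * ψ n := by
          gcongr
          rw [div_le_one hNpos]
          exact_mod_cast hN
      _ = ψ n := one_mul _
  rw [hsplit, sum_devCoef_mul_pow hpn]
  have hdec : (ψ n : ℂ) * z ^ (n - p) * ∑ j ∈ Finset.range p, (((j : ℝ) / p : ℝ) : ℂ) * z ^ j
      - ∑ k ∈ Finset.range n, (((k : ℝ) / N * devCoef ψ n p k : ℝ) : ℂ) * z ^ k
      + z ^ n * ∑ j ∈ Finset.range (N - n),
        ((fejerWeight N (n + j) * ψ (n + j) : ℝ) : ℂ) * z ^ j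
      - (z ^ n * mq - ψ n * z ^ (n - p) * (z ^ p * mp)) =
      ψ n * z ^ (n - p) * (∑ j ∈ Finset.range p, (((j : ℝ) / p : ℝ) : ℂ) * z ^ j + z ^ p * mp)
      + z ^ n * (∑ j ∈ Finset.range (N - n),
        ((fejerWeight N (n + j) * ψ (n + j) : ℝ) : ℂ) * z ^ j - mq)
      - ∑ k ∈ Finset.range n, (((k : ℝ) / N * devCoef ψ n p k : ℝ) : ℂ) * z ^ k := by ring
  rw [hdec]
  refine (norm_sub_le _ _).trans (add_le_add ((norm_add_le _ _).trans ?_) herr)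
  rw [norm_mul, norm_mul, norm_mul, norm_pow, norm_pow, hz, one_pow, one_pow, one_mul, mul_one,
    Complex.norm_real, Real.norm_of_nonneg hD]

theorem measurable_modelKernel (D : ℝ) (n p : ℕ) (q θ : ℝ) :
    Measurable (modelKernel D n p q θ) := by
  have h : ∀ a : ℝ, Measurable fun t : ℝ => (if a < |t| then (1 : ℝ) else 0) := fun a =>
    Measurable.ite (measurableSet_lt measurable_const (by fun_prop)) measurable_const
      measurable_const
  unfold modelKernel
  exact (((h _).sub (h _)).const_mul D).mul (by fun_prop)

theorem abs_modelKernel_le {D : ℝ} (hD : 0 ≤ D) (n p : ℕ) {q : ℝ} (hq : 1 ≤ q) (hp : 1 ≤ p)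
    (θ t : ℝ) : |modelKernel D n p q θ t| ≤ D * (p + q) := by
  have hp0 : (0 : ℝ) < p := by exact_mod_cast hp
  have hq0 : 0 < q := by linarith
  have hs := Real.abs_sin_le_one (n * t + θ)
  rw [modelKernel, mul_assoc, abs_mul, abs_of_nonneg hD]
  gcongr
  have key : ∀ a : ℝ, 0 < a → |(if 1 / a < |t| then (1 : ℝ) else 0) *
      (Real.sin (n * t + θ) / t)| ≤ a := fun a ha => by
    split_ifs with h
    · have ht : 0 < |t| := lt_trans (by positivity) h
      rw [one_mul, abs_div, div_le_iff₀ ht]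
      rw [div_lt_iff₀ ha] at h
      nlinarith
    · simp [ha.le]
  rw [sub_mul]
  exact (abs_sub _ _).trans (add_le_add (key p hp0) (key q hq0))

theorem continuous_devKernel (ψ : ℕ → ℝ) (n p N : ℕ) (θ : ℝ) :
    Continuous (devKernel ψ n p N θ) := by
  unfold devKernel
  fun_prop

theorem integral_devKernel_sub_modelKernel_le {ψ : ℕ → ℝ} {n p N : ℕ} {q A : ℝ} (hp : 1 ≤ p)
    (hpn : p ≤ n) (h : RegularTail ψ n q A) (hD : 0 < ψ n) (hN : n ^ 2 ≤ N) (hnN : n ≤ N)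
    (hqN : n * q ≤ N) (θ : ℝ) :
    ∫ t in (0 : ℝ)..π, |devKernel ψ n p N θ t - modelKernel (ψ n) n p q θ t| ≤
      (18 * A + 71) * ψ n := by
  have hN0 : 0 < N := by omega
  have hA := h.const_nonneg hD
  have hq0 : 0 < q := by linarith [h.one_le]
  have hNpos : (0 : ℝ) < N := by exact_mod_cast hN0
  set d : ℕ → ℝ := fun j => fejerWeight N (n + j) * ψ (n + j) with hd
  have hfa : Antitone fun j => fejerWeight N (n + j) := fun a b hab =>
    fejerWeight_antitone N (by omega)
  have hfc : Antitone fun j => fejerWeight N (n + j) - fejerWeight N (n + (j + 1)) :=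
    fun a b hab => fejerWeight_convex hN0 (by omega : n + a ≤ n + b)
  have hnq : (n : ℝ) / N ≤ 1 / q := by
    rw [div_le_div_iff₀ hNpos hq0]; linarith
  have hn1 : (1 : ℝ) ≤ n := by exact_mod_cast hp.trans hpn
  have hNq : 1 / (N : ℝ) ≤ 1 / q := le_trans (by gcongr) hnq
  have hd0 : d 0 = (1 - (n : ℝ) / N) * ψ n := by
    simp only [hd, add_zero, fejerWeight_of_le hnN]
  have hnN0 : 0 ≤ (n : ℝ) / N := by positivity
  have tail := integral_tail_sub_model_le (d := d) (M := N - n) (q := q) (D := ψ n) (A := A + 1)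
    (antitone_mul_of_nonneg hfa h.antitone (fun _ => fejerWeight_nonneg _ _) h.nonneg)
    (fun j => mul_nonneg (fejerWeight_nonneg _ _) (h.nonneg j))
    (antitone_mul_sub_succ hfa h.antitone (fun _ => fejerWeight_nonneg _ _) h.nonneg hfc h.convex)
    (by simp only [hd, fejerWeight_of_ge hN0 (show N ≤ n + (N - n) by omega), zero_mul])
    h.one_le hD.le (by linarith) (by rw [hd0]; nlinarith)
    (by
      rw [hd0, div_eq_mul_one_div (ψ n) q]
      nlinarith)
    (by
      have h1 : d 0 - d 1 = fejerWeight N n * (ψ n - ψ (n + 1)) +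
          ψ (n + 1) * (fejerWeight N n - fejerWeight N (n + 1)) := by
        simp only [hd, add_zero]; ring
      have h2 : fejerWeight N n - fejerWeight N (n + 1) ≤ 1 / q := by
        rw [fejerWeight_sub_succ hN0]
        split_ifs
        · exact hNq
        · positivity
      have h3 : ψ (n + 1) ≤ ψ n := h.antitone (Nat.zero_le 1)
      have h4 : fejerWeight N n * (ψ n - ψ (n + 1)) ≤ 1 * (ψ n - ψ (n + 1)) :=
        mul_le_mul_of_nonneg_right (fejerWeight_le_one _ _) (sub_nonneg.2 h3)
      have h5 : ψ (n + 1) * (fejerWeight N n - fejerWeight N (n + 1)) ≤ ψ n * (1 / q) :=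
        mul_le_mul h3 h2 (sub_nonneg.2 (fejerWeight_antitone N (Nat.le_succ n))) hD.le
      have h6 : (A + 1) * ψ n / q = A * ψ n / q + ψ n * (1 / q) := by ring
      rw [h1, h6]
      linarith [h.step])
    (by
      refine le_trans (Finset.sum_le_sum fun j _ => ?_) ((h.sum_le (N - n)).trans (by nlinarith))
      have : 0 ≤ min (1 / q) (1 / ((j : ℝ) + 1)) := by positivity
      exact mul_le_mul_of_nonneg_right
        (mul_le_of_le_one_left (h.nonneg j) (fejerWeight_le_one _ _)) this)
  have ramp := integral_ramp_add_model_le hp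
  have hint1 : IntervalIntegrable (fun t : ℝ => ‖∑ j ∈ Finset.range p,
        (((j : ℝ) / p : ℝ) : ℂ) * Complex.exp (Complex.I * t) ^ j
      + Complex.exp (Complex.I * t) ^ p *
        (if 1 / (p : ℝ) < t then ((1 : ℝ) : ℂ) * (Complex.I / t) else 0)‖) volume 0 π := by
    refine (IntervalIntegrable.add (Continuous.intervalIntegrable (by fun_prop) _ _)
      (IntervalIntegrable.continuousOn_mul ?_ (by fun_prop))).norm
    exact intervalIntegrable_of_measurable_of_norm_le (measurable_model _ _)
      (norm_model_le (by positivity) zero_le_one) _ _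
  have hint2 : IntervalIntegrable (fun t : ℝ => ‖∑ j ∈ Finset.range (N - n), (d j : ℂ) *
          Complex.exp (Complex.I * t) ^ j
        - (if 1 / q < t then (ψ n : ℂ) * (Complex.I / t) else 0)‖) volume 0 π := by
    refine (IntervalIntegrable.sub (Continuous.intervalIntegrable (by fun_prop) _ _) ?_).norm
    exact intervalIntegrable_of_measurable_of_norm_le (measurable_model _ _)
      (norm_model_le (by positivity) hD.le) _ _
  have hint0 : IntervalIntegrable (fun t =>
      |devKernel ψ n p N θ t - modelKernel (ψ n) n p q θ t|) volume 0 π :=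
    (((continuous_devKernel ψ n p N θ).intervalIntegrable _ _).sub
      (intervalIntegrable_of_measurable_of_norm_le (measurable_modelKernel _ _ _ _ _)
        (abs_modelKernel_le hD.le n p h.one_le hp θ) _ _)).abs
  have hmono := intervalIntegral.integral_mono_on_of_le_Ioo Real.pi_pos.le hint0
    (((hint1.const_mul (ψ n)).add hint2).add (intervalIntegrable_const (c := ψ n)))
    fun t ht => abs_devKernel_sub_modelKernel_le hpn hD.le hN hnN hN0 q θ ht.1
  refine hmono.trans ?_
  rw [intervalIntegral.integral_add ((hint1.const_mul (ψ n)).add hint2) intervalIntegrable_const,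
    intervalIntegral.integral_add (hint1.const_mul (ψ n)) hint2,
    intervalIntegral.integral_const_mul, intervalIntegral.integral_const, smul_eq_mul]
  have hπ : (π - 0) * ψ n ≤ 4 * ψ n := by nlinarith [Real.pi_le_four]
  have hr := mul_le_mul_of_nonneg_left ramp hD.le
  linarith

/-! ### The `L¹` norm of the model kernel -/

theorem exists_bound_integral_abs_sin_sub :
    ∃ C > 0, ∀ x : ℝ, |∫ u in (0 : ℝ)..x, (|Real.sin u| - 2 / π)| ≤ C := by
  have hcont : Continuous fun u : ℝ => |Real.sin u| - 2 / π := by fun_prop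
  have hper : Function.Periodic (fun u : ℝ => |Real.sin u| - 2 / π) π := fun u => by
    simp [Real.sin_add_pi]
  have hzero : ∫ u in (0 : ℝ)..π, (|Real.sin u| - 2 / π) = 0 := by
    rw [intervalIntegral.integral_sub (Continuous.intervalIntegrable (by fun_prop) _ _)
      intervalIntegrable_const, intervalIntegral.integral_const, smul_eq_mul, sub_zero,
      mul_div_cancel₀ _ Real.pi_ne_zero]
    have : ∫ u in (0 : ℝ)..π, |Real.sin u| = ∫ u in (0 : ℝ)..π, Real.sin u := by
      refine intervalIntegral.integral_congr fun u hu => ?_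
      rw [uIcc_of_le Real.pi_pos.le] at hu
      exact abs_of_nonneg (Real.sin_nonneg_of_mem_Icc hu)
    rw [this, integral_sin]
    norm_num
  have hGper : Function.Periodic (fun x : ℝ => ∫ u in (0 : ℝ)..x, (|Real.sin u| - 2 / π)) π := by
    intro x
    have h := hper.intervalIntegral_add_eq x 0
    rw [zero_add, hzero] at h
    simp only
    rw [← intervalIntegral.integral_add_adjacent_intervals (b := x)
      (hcont.intervalIntegrable _ _) (hcont.intervalIntegrable _ _), h, add_zero]
  have hGcont : Continuous fun x : ℝ => ∫ u in (0 : ℝ)..x, (|Real.sin u| - 2 / π) :=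
    intervalIntegral.continuous_primitive (fun a b => hcont.intervalIntegrable a b) 0
  obtain ⟨C, hC⟩ := (hGper.isBounded_of_continuous Real.pi_ne_zero hGcont).exists_norm_le
  refine ⟨|C| + 1, by positivity, fun x => ?_⟩
  have := hC _ (mem_range_self x)
  rw [Real.norm_eq_abs] at this
  linarith [le_abs_self C]

theorem exists_bound_integral_abs_sin_div :
    ∃ C > 0, ∀ (n θ a b : ℝ), 0 < n → 0 < a → a ≤ b →
      |(∫ t in a..b, |Real.sin (n * t + θ)| / t) - 2 / π * Real.log (b / a)| ≤ C / (n * a) := by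
  obtain ⟨C, hC0, hC⟩ := exists_bound_integral_abs_sin_sub
  refine ⟨2 * C, by positivity, fun n θ a b hn ha hab => ?_⟩
  have hb : 0 < b := ha.trans_le hab
  have hpos : ∀ t ∈ uIcc a b, 0 < t := fun t ht => by
    rw [uIcc_of_le hab] at ht; exact ha.trans_le ht.1
  have h0 : (0 : ℝ) ∉ uIcc a b := fun h => lt_irrefl _ (hpos 0 h)
  set G : ℝ → ℝ := fun x => ∫ u in (0 : ℝ)..x, (|Real.sin u| - 2 / π) with hG
  have hcont : Continuous fun u : ℝ => |Real.sin u| - 2 / π := by fun_prop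
  have hGd : ∀ x, HasDerivAt G (|Real.sin x| - 2 / π) x := fun x =>
    intervalIntegral.integral_hasDerivAt_right (hcont.intervalIntegrable _ _)
      (hcont.stronglyMeasurableAtFilter _ _) hcont.continuousAt
  have hv : ∀ t ∈ uIcc a b, HasDerivAt (fun t => G (n * t + θ) / n)
      (|Real.sin (n * t + θ)| - 2 / π) t := fun t _ => by
    have h1 : HasDerivAt (fun t : ℝ => n * t + θ) n t := by
      simpa using ((hasDerivAt_id t).const_mul n).add_const θ
    have h2 := ((hGd (n * t + θ)).comp t h1).div_const n
    simpa [Function.comp_def, hn.ne'] using h2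
  have hu : ∀ t ∈ uIcc a b, HasDerivAt (fun t : ℝ => t⁻¹) (-(t ^ 2)⁻¹) t := fun t ht =>
    hasDerivAt_inv (hpos t ht).ne'
  have hGc : Continuous G := continuous_iff_continuousAt.2 fun x => (hGd x).continuousAt
  have hui : IntervalIntegrable (fun t : ℝ => -(t ^ 2)⁻¹) volume a b := by
    refine ContinuousOn.intervalIntegrable (ContinuousOn.neg (ContinuousOn.inv₀ (by fun_prop) ?_))
    exact fun t ht => pow_ne_zero _ (hpos t ht).ne'
  have hvi : IntervalIntegrable (fun t : ℝ => |Real.sin (n * t + θ)| - 2 / π) volume a b :=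
    Continuous.intervalIntegrable (by fun_prop) _ _
  have parts := intervalIntegral.integral_mul_deriv_eq_deriv_mul hu hv hui hvi
  have hinv : IntervalIntegrable (fun t : ℝ => t⁻¹) volume a b :=
    intervalIntegral.intervalIntegrable_inv (fun t ht => (hpos t ht).ne') continuousOn_id
  have hlhs : ∫ t in a..b, t⁻¹ * (|Real.sin (n * t + θ)| - 2 / π) =
      (∫ t in a..b, |Real.sin (n * t + θ)| / t) - 2 / π * Real.log (b / a) := by
    rw [← integral_inv h0, ← intervalIntegral.integral_const_mul,
      ← intervalIntegral.integral_sub ?_ (hinv.const_mul _)]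
    · refine intervalIntegral.integral_congr fun t _ => ?_
      ring
    · refine ContinuousOn.intervalIntegrable (ContinuousOn.div (by fun_prop) (by fun_prop) ?_)
      exact fun t ht => (hpos t ht).ne'
  have hGn : ∀ t, |G (n * t + θ) / n| ≤ C / n := fun t => by
    rw [abs_div, abs_of_pos hn]; gcongr; exact hC _
  have hsq : ∫ t in a..b, -(t ^ 2)⁻¹ = b⁻¹ - a⁻¹ :=
    intervalIntegral.integral_eq_sub_of_hasDerivAt hu hui
  have hlast : |∫ t in a..b, -(t ^ 2)⁻¹ * (G (n * t + θ) / n)| ≤ (a⁻¹ - b⁻¹) * (C / n) := by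
    rw [← Real.norm_eq_abs]
    refine (intervalIntegral.norm_integral_le_of_norm_le (g := fun t => -(-(t ^ 2)⁻¹ * (C / n))) hab
      (Eventually.of_forall fun t ht => ?_) (hui.mul_const _).neg).trans (le_of_eq ?_)
    · rw [norm_mul, norm_neg, Real.norm_of_nonneg (by positivity), Real.norm_eq_abs,
        neg_mul, neg_neg]
      gcongr
      exact hGn t
    · rw [intervalIntegral.integral_neg, intervalIntegral.integral_mul_const, hsq]
      ring
  rw [hlhs] at parts
  rw [parts]
  have e1 : |b⁻¹ * (G (n * b + θ) / n)| ≤ b⁻¹ * (C / n) := by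
    rw [abs_mul, abs_of_pos (inv_pos.2 hb)]; gcongr; exact hGn b
  have e2 : |a⁻¹ * (G (n * a + θ) / n)| ≤ a⁻¹ * (C / n) := by
    rw [abs_mul, abs_of_pos (inv_pos.2 ha)]; gcongr; exact hGn a
  calc _ ≤ |b⁻¹ * (G (n * b + θ) / n)| + |a⁻¹ * (G (n * a + θ) / n)|
        + |∫ t in a..b, -(t ^ 2)⁻¹ * (G (n * t + θ) / n)| :=
        (abs_sub _ _).trans (add_le_add (abs_sub _ _) le_rfl)
    _ ≤ b⁻¹ * (C / n) + a⁻¹ * (C / n) + (a⁻¹ - b⁻¹) * (C / n) := by gcongr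
    _ = 2 * C / (n * a) := by field_simp; ring

theorem integral_eq_of_eq_on_middle {F H : ℝ → ℝ} (hF : IntervalIntegrable F volume 0 π) {a b : ℝ}
    (ha : 0 ≤ a) (hab : a ≤ b) (hb : b ≤ π) (h1 : ∀ t, 0 < t → t ≤ a → F t = 0)
    (h2 : ∀ t, a < t → t ≤ b → F t = H t) (h3 : ∀ t, b < t → t ≤ π → F t = 0) :
    ∫ t in (0 : ℝ)..π, F t = ∫ t in a..b, H t := by
  have hsub : ∀ x y, 0 ≤ x → x ≤ y → y ≤ π → IntervalIntegrable F volume x y :=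
    fun x y hx hxy hy => hF.mono_set (by
      rw [uIcc_of_le hxy, uIcc_of_le Real.pi_pos.le]; exact Icc_subset_Icc hx hy)
  rw [← intervalIntegral.integral_add_adjacent_intervals (hsub 0 a le_rfl ha (hab.trans hb))
      (hsub a π ha (hab.trans hb) le_rfl),
    ← intervalIntegral.integral_add_adjacent_intervals (hsub a b ha hab hb)
      (hsub b π (ha.trans hab) hb le_rfl)]
  have e1 : ∫ t in (0 : ℝ)..a, F t = ∫ t in (0 : ℝ)..a, (0 : ℝ) :=
    intervalIntegral.integral_congr_ae (Eventually.of_forall fun t ht => by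
      rw [uIoc_of_le ha] at ht; exact h1 t ht.1 ht.2)
  have e2 : ∫ t in a..b, F t = ∫ t in a..b, H t :=
    intervalIntegral.integral_congr_ae (Eventually.of_forall fun t ht => by
      rw [uIoc_of_le hab] at ht; exact h2 t ht.1 ht.2)
  have e3 : ∫ t in b..π, F t = ∫ t in b..π, (0 : ℝ) :=
    intervalIntegral.integral_congr_ae (Eventually.of_forall fun t ht => by
      rw [uIoc_of_le hb] at ht; exact h3 t ht.1 ht.2)
  rw [e1, e2, e3]
  simp

theorem intervalIntegrable_modelKernel {D : ℝ} (hD : 0 ≤ D) (n p : ℕ) {q : ℝ} (hq : 1 ≤ q)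
    (hp : 1 ≤ p) (θ a b : ℝ) : IntervalIntegrable (modelKernel D n p q θ) volume a b :=
  intervalIntegrable_of_measurable_of_norm_le (measurable_modelKernel _ _ _ _ _)
    (abs_modelKernel_le hD n p hq hp θ) _ _

theorem abs_modelKernel_eq {D : ℝ} (hD : 0 ≤ D) (n p : ℕ) (q θ : ℝ) {t : ℝ} (ht : 0 < t) :
    |modelKernel D n p q θ t| = |(if 1 / (p : ℝ) < t then (1 : ℝ) else 0) -
      (if 1 / q < t then 1 else 0)| * (D * (|Real.sin (n * t + θ)| / t)) := by
  rw [modelKernel, abs_of_pos ht, abs_mul, abs_mul, abs_div, abs_of_pos ht, abs_of_nonneg hD]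
  ring

theorem exists_bound_integral_abs_modelKernel :
    ∃ C > 0, ∀ (D : ℝ) (n p : ℕ) (q θ A : ℝ), 0 ≤ D → 1 ≤ p → p ≤ n → 1 ≤ q → q ≤ A * n → 1 ≤ A →
      |(∫ t in (0 : ℝ)..π, |modelKernel D n p q θ t|) -
        D * (2 / π * |Real.log p - Real.log q|)| ≤ C * A * D := by
  obtain ⟨C, hC0, hC⟩ := exists_bound_integral_abs_sin_div
  refine ⟨C, hC0, fun D n p q θ A hD hp hpn hq hqn hA => ?_⟩
  have hp0 : (0 : ℝ) < p := by exact_mod_cast hp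
  have hp1 : (1 : ℝ) ≤ p := by exact_mod_cast hp
  have hpn' : (p : ℝ) ≤ n := by exact_mod_cast hpn
  have hn0 : (0 : ℝ) < n := hp0.trans_le hpn'
  have hq0 : 0 < q := by linarith
  have hπ := Real.pi_gt_three
  have hpπ : 1 / (p : ℝ) ≤ π := ((div_le_one hp0).2 hp1).trans (by linarith)
  have hqπ : 1 / q ≤ π := ((div_le_one hq0).2 hq).trans (by linarith)
  have hF := (intervalIntegrable_modelKernel hD n p hq hp θ 0 π).abs
  have main : ∀ s : ℝ, 0 < s → s ≤ A * n → C / (n * (1 / s)) ≤ C * A := fun s hs hsn => by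
    rw [mul_one_div, div_div_eq_mul_div, mul_div_assoc]
    gcongr
    rwa [div_le_iff₀ hn0]
  have fin : ∀ I L s : ℝ, |I - L| ≤ C / (n * (1 / s)) → 0 < s → s ≤ A * n →
      |D * I - D * L| ≤ C * A * D := fun I L s h hs hsn => by
    rw [← mul_sub, abs_mul, abs_of_nonneg hD, mul_comm]
    gcongr
    exact h.trans (main s hs hsn)
  rcases le_total (p : ℝ) q with hpq | hpq
  · have hle : 1 / q ≤ 1 / (p : ℝ) := by gcongr
    rw [integral_eq_of_eq_on_middle (H := fun t => D * (|Real.sin (n * t + θ)| / t)) hF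
      (by positivity) hle hpπ
      (fun t ht h => by rw [abs_modelKernel_eq hD _ _ _ _ ht, if_neg (by linarith),
        if_neg (by linarith)]; simp)
      (fun t ht h => by rw [abs_modelKernel_eq hD _ _ _ _ (lt_trans (by positivity) ht),
        if_neg (by linarith), if_pos (by linarith)]; simp)
      (fun t ht h => by rw [abs_modelKernel_eq hD _ _ _ _ (lt_trans (by positivity) ht),
        if_pos (by linarith), if_pos (by linarith)]; simp),
      intervalIntegral.integral_const_mul]
    refine fin _ _ q ?_ hq0 hqn
    have hlog : |Real.log p - Real.log q| = Real.log (1 / p / (1 / q)) := by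
      rw [abs_sub_comm, abs_of_nonneg (sub_nonneg.2 (Real.log_le_log hp0 hpq)),
        ← Real.log_div hq0.ne' hp0.ne']
      congr 1
      field_simp
    rw [hlog]
    exact hC n θ (1 / q) (1 / p) hn0 (by positivity) hle
  · have hle : 1 / (p : ℝ) ≤ 1 / q := by gcongr
    rw [integral_eq_of_eq_on_middle (H := fun t => D * (|Real.sin (n * t + θ)| / t)) hF
      (by positivity) hle hqπ
      (fun t ht h => by rw [abs_modelKernel_eq hD _ _ _ _ ht, if_neg (by linarith),
        if_neg (by linarith)]; simp)
      (fun t ht h => by rw [abs_modelKernel_eq hD _ _ _ _ (lt_trans (by positivity) ht),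
        if_pos (by linarith), if_neg (by linarith)]; simp)
      (fun t ht h => by rw [abs_modelKernel_eq hD _ _ _ _ (lt_trans (by positivity) ht),
        if_pos (by linarith), if_pos (by linarith)]; simp),
      intervalIntegral.integral_const_mul]
    refine fin _ _ p ?_ hp0 (by nlinarith)
    have hlog : |Real.log p - Real.log q| = Real.log (1 / q / (1 / p)) := by
      rw [abs_of_nonneg (sub_nonneg.2 (Real.log_le_log hq0 hpq)),
        ← Real.log_div hp0.ne' hq0.ne']
      congr 1
      field_simp
    rw [hlog]
    exact hC n θ (1 / p) (1 / q) hn0 (by positivity) hle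

theorem modelKernel_neg (D : ℝ) (n p : ℕ) (q θ t : ℝ) :
    modelKernel D n p q θ (-t) = modelKernel D n p q (-θ) t := by
  rw [modelKernel, modelKernel, abs_neg, div_neg, ← neg_div, ← Real.sin_neg]
  congr 4
  ring

theorem devKernel_neg (ψ : ℕ → ℝ) (n p N : ℕ) (θ t : ℝ) :
    devKernel ψ n p N θ (-t) = devKernel ψ n p N (-θ) t := by
  refine Finset.sum_congr rfl fun k _ => ?_
  rw [← Real.cos_neg]
  congr 2
  ring

theorem integral_symm_eq {F : ℝ → ℝ} (hF : IntervalIntegrable F volume (-π) π) :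
    ∫ t in (-π)..π, F t = (∫ t in (0 : ℝ)..π, F t) + ∫ t in (0 : ℝ)..π, F (-t) := by
  have hsub : ∀ x y, -π ≤ x → x ≤ y → y ≤ π → IntervalIntegrable F volume x y :=
    fun x y hx hxy hy => hF.mono_set (by
      rw [uIcc_of_le hxy, uIcc_of_le (by linarith [Real.pi_pos])]; exact Icc_subset_Icc hx hy)
  have hπ := Real.pi_pos
  rw [intervalIntegral.integral_comp_neg, neg_zero, add_comm,
    intervalIntegral.integral_add_adjacent_intervals (hsub _ _ le_rfl (by linarith) (by linarith))
      (hsub _ _ (by linarith) (by linarith) le_rfl)]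

theorem integral_abs_devKernel_sub_modelKernel_le {ψ : ℕ → ℝ} {n p N : ℕ} {q A : ℝ} (hp : 1 ≤ p)
    (hpn : p ≤ n) (h : RegularTail ψ n q A) (hD : 0 < ψ n) (hN : n ^ 2 ≤ N) (hnN : n ≤ N)
    (hqN : n * q ≤ N) (θ : ℝ) :
    ∫ t in (-π)..π, |devKernel ψ n p N θ t - modelKernel (ψ n) n p q θ t| ≤
      (36 * A + 142) * ψ n := by
  rw [integral_symm_eq]
  · simp only [devKernel_neg, modelKernel_neg]
    linarith [integral_devKernel_sub_modelKernel_le hp hpn h hD hN hnN hqN θ,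
      integral_devKernel_sub_modelKernel_le hp hpn h hD hN hnN hqN (-θ)]
  · exact (((continuous_devKernel ψ n p N θ).intervalIntegrable _ _).sub
      (intervalIntegrable_modelKernel hD.le n p h.one_le hp θ _ _)).abs

theorem exists_bound_integral_symm_abs_modelKernel :
    ∃ C > 0, ∀ (D : ℝ) (n p : ℕ) (q θ A : ℝ), 0 ≤ D → 1 ≤ p → p ≤ n → 1 ≤ q → q ≤ A * n → 1 ≤ A →
      |(∫ t in (-π)..π, |modelKernel D n p q θ t|) -
        D * (4 / π * |Real.log p - Real.log q|)| ≤ C * A * D := by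
  obtain ⟨C, hC0, hC⟩ := exists_bound_integral_abs_modelKernel
  refine ⟨2 * C, by positivity, fun D n p q θ A hD hp hpn hq hqn hA => ?_⟩
  rw [integral_symm_eq (intervalIntegrable_modelKernel hD n p hq hp θ _ _).abs]
  simp only [modelKernel_neg]
  have h1 := abs_le.1 (hC D n p q θ A hD hp hpn hq hqn hA)
  have h2 := abs_le.1 (hC D n p q (-θ) A hD hp hpn hq hqn hA)
  have h3 : D * (4 / π * |Real.log p - Real.log q|) =
      D * (2 / π * |Real.log p - Real.log q|) + D * (2 / π * |Real.log p - Real.log q|) := by ring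
  rw [abs_le, h3]
  constructor <;> linarith [h1.1, h1.2, h2.1, h2.2]

/-! ### Fejér means -/

/-- The factor relating the `k`-th harmonic to `cos (k t)` in the Fejér kernel. -/
def harmFactor (k : ℕ) : ℝ := if k = 0 then 1 else 2

theorem harmFactor_succ (k : ℕ) : harmFactor (k + 1) = 2 := if_neg (Nat.succ_ne_zero k)

/-- The Fejér kernel. -/
def fejerKernel (N : ℕ) (t : ℝ) : ℝ :=
  ∑ k ∈ Finset.range N, fejerWeight N k * (harmFactor k * Real.cos (k * t))

/-- The Fejér means of `f`. -/
def fejerMean (N : ℕ) (f : ℝ → ℝ) (x : ℝ) : ℝ :=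
  ∑ k ∈ Finset.range N, fejerWeight N k * harmonicTerm f k x

theorem continuous_fejerKernel (N : ℕ) : Continuous (fejerKernel N) := by
  unfold fejerKernel; fun_prop

theorem sq_norm_sum_expI_pow (N : ℕ) (t : ℝ) :
    ‖∑ j ∈ Finset.range N, Complex.exp (Complex.I * t) ^ j‖ ^ 2 =
      ∑ k ∈ Finset.range N, ((N : ℝ) - k) * (harmFactor k * Real.cos (k * t)) := by
  have hre : ∀ j : ℕ, (Complex.exp (Complex.I * t) ^ j).re = Real.cos (j * t) := fun j => by
    rw [← Complex.exp_nat_mul, show (j : ℂ) * (Complex.I * t) = ((j * t : ℝ) : ℂ) * Complex.I by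
      push_cast; ring, Complex.exp_ofReal_mul_I_re]
  have him : ∀ j : ℕ, (Complex.exp (Complex.I * t) ^ j).im = Real.sin (j * t) := fun j => by
    rw [← Complex.exp_nat_mul, show (j : ℂ) * (Complex.I * t) = ((j * t : ℝ) : ℂ) * Complex.I by
      push_cast; ring, Complex.exp_ofReal_mul_I_im]
  rw [Complex.sq_norm, Complex.normSq_apply, Complex.re_sum, Complex.im_sum]
  simp only [hre, him]
  induction N with
  | zero => simp
  | succ N ih =>
    have hdir : ∑ k ∈ Finset.range (N + 1), harmFactor k * Real.cos (k * t) =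
        1 + 2 * ∑ j ∈ Finset.range N, (Real.cos (j * t) * Real.cos (N * t)
          + Real.sin (j * t) * Real.sin (N * t)) := by
      rw [Finset.sum_range_succ', add_comm, Finset.mul_sum,
        ← Finset.sum_range_reflect (fun k => harmFactor (k + 1) * Real.cos ((k + 1 : ℕ) * t))]
      congr 1
      · simp [harmFactor]
      · refine Finset.sum_congr rfl fun j hj => ?_
        have hj' := Finset.mem_range.1 hj
        rw [harmFactor_succ, show N - 1 - j + 1 = N - j by omega, Nat.cast_sub hj'.le,
          ← Real.cos_sub, ← Real.cos_neg]
        congr 2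
        ring
    have hstep : ∑ k ∈ Finset.range (N + 1), (((N + 1 : ℕ) : ℝ) - k) *
          (harmFactor k * Real.cos (k * t)) =
        ∑ k ∈ Finset.range N, ((N : ℝ) - k) * (harmFactor k * Real.cos (k * t)) +
          ∑ k ∈ Finset.range (N + 1), harmFactor k * Real.cos (k * t) := by
      rw [Finset.sum_range_succ, Finset.sum_range_succ (fun k => harmFactor k * Real.cos (k * t)),
        ← add_assoc, ← Finset.sum_add_distrib]
      congr 1
      · exact Finset.sum_congr rfl fun k _ => by push_cast; ring
      · push_cast; ring
    rw [hstep, hdir, ← ih, Finset.sum_range_succ, Finset.sum_range_succ, Finset.sum_add_distrib,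
      ← Finset.sum_mul, ← Finset.sum_mul]
    linear_combination Real.cos_sq_add_sin_sq (N * t)

theorem fejerKernel_eq {N : ℕ} (hN : 0 < N) (t : ℝ) :
    fejerKernel N t = ‖∑ j ∈ Finset.range N, Complex.exp (Complex.I * t) ^ j‖ ^ 2 / N := by
  have hN' : (N : ℝ) ≠ 0 := by exact_mod_cast hN.ne'
  rw [sq_norm_sum_expI_pow, fejerKernel, Finset.sum_div]
  refine Finset.sum_congr rfl fun k hk => ?_
  rw [fejerWeight_of_le (Finset.mem_range.1 hk).le]
  field_simp

theorem fejerKernel_nonneg (N : ℕ) (t : ℝ) : 0 ≤ fejerKernel N t := by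
  rcases Nat.eq_zero_or_pos N with rfl | hN
  · simp [fejerKernel]
  · rw [fejerKernel_eq hN]; positivity

theorem fejerKernel_neg (N : ℕ) (t : ℝ) : fejerKernel N (-t) = fejerKernel N t :=
  Finset.sum_congr rfl fun k _ => by rw [mul_neg, Real.cos_neg]

theorem fejerKernel_le {N : ℕ} (hN : 0 < N) {t : ℝ} (h0 : t ≠ 0) (h1 : |t| ≤ π) :
    fejerKernel N t ≤ 16 / t ^ 2 / N := by
  have hpos : 0 < |t| := abs_pos.2 h0
  have hsymm : fejerKernel N t = fejerKernel N |t| := by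
    rcases abs_choice t with h | h <;> rw [h]
    rw [fejerKernel_neg]
  rw [hsymm, fejerKernel_eq hN]
  gcongr
  have h := norm_one_sub_mul_sum_le (d := fun _ => 1) antitone_const (fun _ => zero_le_one)
    (norm_expI |t|) N
  simp only [Complex.ofReal_one, one_mul, mul_one, norm_mul] at h
  have hl := half_le_norm_one_sub_expI hpos.le h1
  rw [le_div_iff₀ (by positivity), ← sq_abs t, ← mul_pow]
  have hn := norm_nonneg (∑ j ∈ Finset.range N, Complex.exp (Complex.I * |t|) ^ j)
  have : ‖∑ j ∈ Finset.range N, Complex.exp (Complex.I * |t|) ^ j‖ * |t| ≤ 4 := by nlinarith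
  calc _ ≤ (4 : ℝ) ^ 2 := by gcongr
    _ = 16 := by norm_num

theorem integral_cos_natMul {k : ℕ} (hk : k ≠ 0) (c : ℝ) :
    ∫ t in (-π)..π, Real.cos (k * t + c) = 0 := by
  have hk' : (k : ℝ) ≠ 0 := by exact_mod_cast hk
  rw [intervalIntegral.integral_comp_mul_add _ hk', integral_cos,
    show (k : ℝ) * π + c = k * -π + c + k * (2 * π) by ring, Real.sin_add_nat_mul_two_pi, sub_self,
    smul_zero]

theorem integral_fejerKernel {N : ℕ} (hN : 0 < N) : ∫ t in (-π)..π, fejerKernel N t = 2 * π := by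
  unfold fejerKernel
  rw [intervalIntegral.integral_finsetSum
    fun k _ => Continuous.intervalIntegrable (by fun_prop) _ _, Finset.sum_eq_single 0]
  · simp [harmFactor, fejerWeight]
    ring
  · intro k _ hk
    have := integral_cos_natMul hk 0
    simp only [add_zero] at this
    rw [intervalIntegral.integral_const_mul, intervalIntegral.integral_const_mul, this]
    simp
  · simp [hN.ne']

theorem integral_sub_eq_of_periodic {h : ℝ → ℝ} (hh : Function.Periodic h (2 * π)) (x : ℝ) :
    ∫ t in (-π)..π, h (t - x) = ∫ t in (-π)..π, h t := by
  rw [intervalIntegral.integral_comp_sub_right]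
  have := hh.intervalIntegral_add_eq (-π - x) (-π)
  rw [show -π - x + 2 * π = π - x by ring, show -π + 2 * π = π by ring] at this
  exact this

theorem fejerKernel_periodic (N : ℕ) : Function.Periodic (fejerKernel N) (2 * π) := fun t => by
  refine Finset.sum_congr rfl fun k _ => ?_
  rw [mul_add, Real.cos_add_nat_mul_two_pi]

theorem harmonicTerm_eq {f : ℝ → ℝ} (hf : IntervalIntegrable f volume (-π) π) (k : ℕ) (x : ℝ) :
    harmonicTerm f k x =
      1 / (2 * π) * ∫ t in (-π)..π, f t * (harmFactor k * Real.cos (k * (t - x))) := by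
  rcases Nat.eq_zero_or_pos k with rfl | hk
  · simp [harmonicTerm, fourierA, harmFactor]
    ring
  · have hk' : k ≠ 0 := hk.ne'
    rw [harmonicTerm, if_neg hk', fourierA, fourierB, harmFactor, if_neg hk']
    have hc : IntervalIntegrable (fun t => f t * Real.cos (k * t)) volume (-π) π :=
      hf.mul_continuousOn (by fun_prop)
    have hs : IntervalIntegrable (fun t => f t * Real.sin (k * t)) volume (-π) π :=
      hf.mul_continuousOn (by fun_prop)
    have : ∫ t in (-π)..π, f t * (2 * Real.cos (k * (t - x))) =
        2 * Real.cos (k * x) * (∫ t in (-π)..π, f t * Real.cos (k * t)) +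
        2 * Real.sin (k * x) * ∫ t in (-π)..π, f t * Real.sin (k * t) := by
      rw [← intervalIntegral.integral_const_mul, ← intervalIntegral.integral_const_mul,
        ← intervalIntegral.integral_add (hc.const_mul _) (hs.const_mul _)]
      refine intervalIntegral.integral_congr fun t _ => ?_
      simp only [mul_sub, Real.cos_sub]
      ring
    rw [this]
    field_simp

theorem fejerMean_eq {f : ℝ → ℝ} (hf : IntervalIntegrable f volume (-π) π) (N : ℕ) (x : ℝ) :
    fejerMean N f x = 1 / (2 * π) * ∫ t in (-π)..π, f t * fejerKernel N (t - x) := by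
  simp only [fejerMean, harmonicTerm_eq hf, fejerKernel, Finset.mul_sum]
  rw [intervalIntegral.integral_finsetSum fun k _ => hf.mul_continuousOn (by fun_prop),
    Finset.mul_sum]
  refine Finset.sum_congr rfl fun k _ => ?_
  rw [mul_left_comm, ← intervalIntegral.integral_const_mul]
  congr 1
  refine intervalIntegral.integral_congr fun t _ => ?_
  ring

theorem abs_fejerMean_le {f : ℝ → ℝ} (hf : IntervalIntegrable f volume (-π) π)
    (h1 : ∀ t, |f t| ≤ 1) {N : ℕ} (hN : 0 < N) (x : ℝ) : |fejerMean N f x| ≤ 1 := by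
  have hcont : Continuous fun t => fejerKernel N (t - x) :=
    (continuous_fejerKernel N).comp (by fun_prop)
  rw [fejerMean_eq hf, abs_mul, abs_of_pos (by positivity), one_div_mul_eq_div,
    div_le_one (by positivity), ← integral_fejerKernel hN,
    ← integral_sub_eq_of_periodic (fejerKernel_periodic N) x]
  rw [← Real.norm_eq_abs]
  refine intervalIntegral.norm_integral_le_of_norm_le (by linarith [Real.pi_pos])
    (Eventually.of_forall fun t _ => ?_) (hcont.intervalIntegrable _ _)
  rw [norm_mul, Real.norm_of_nonneg (fejerKernel_nonneg _ _)]
  exact mul_le_of_le_one_left (fejerKernel_nonneg _ _) (h1 t)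

/-- The theorem of Fejér: the means of a continuous periodic function converge to it. -/
theorem tendsto_fejerMean {f : ℝ → ℝ} (hf : Continuous f) (hper : Periodic2pi f) (x : ℝ) :
    Tendsto (fun N => fejerMean N f x) atTop (nhds (f x)) := by
  have hπ := Real.pi_pos
  have hshift : ∀ N, fejerMean N f x =
      ∫ t in Ioc (-π) π, (1 / (2 * π) * fejerKernel N t) • f (x + t) := fun N => by
    have hp : Function.Periodic (fun t => f (x + t) * fejerKernel N t) (2 * π) := fun t => by
      simp only [← add_assoc, hper (x + t), fejerKernel_periodic N t]
    rw [fejerMean_eq (hf.intervalIntegrable _ _), ← intervalIntegral.integral_of_le (by linarith)]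
    have h2 := integral_sub_eq_of_periodic hp x
    simp only [add_sub_cancel] at h2
    rw [h2, ← intervalIntegral.integral_const_mul]
    refine intervalIntegral.integral_congr fun t _ => ?_
    simp only [smul_eq_mul]
    ring
  simp only [hshift]
  refine tendsto_setIntegral_peak_smul_of_integrableOn_of_tendsto (x₀ := 0) (t := Ioc (-π) π)
    measurableSet_Ioc measurableSet_Ioc le_rfl self_mem_nhdsWithin measure_Ioc_lt_top.ne
    (Eventually.of_forall fun N t _ => mul_nonneg (by positivity) (fejerKernel_nonneg N t))
    ?_ ?_ (Eventually.of_forall fun N =>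
      ((continuous_fejerKernel N).const_smul (1 / (2 * π))).aestronglyMeasurable) ?_ ?_
  · intro u hu h0
    obtain ⟨δ, hδ, hball⟩ := Metric.isOpen_iff.1 hu 0 h0
    rw [Metric.tendstoUniformlyOn_iff]
    intro ε hε
    have hlim : Tendsto (fun N : ℕ => 16 / δ ^ 2 / (N : ℝ)) atTop (nhds 0) :=
      tendsto_const_div_atTop_nhds_zero_nat _
    filter_upwards [hlim.eventually (gt_mem_nhds hε), eventually_gt_atTop 0] with N hN hN0 t ht
    have hδt : δ ≤ |t| := by
      by_contra! hlt
      exact ht.2 (hball (by simpa using hlt))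
    have hle := fejerKernel_le hN0 (abs_pos.1 (hδ.trans_le hδt)) (abs_le.2 ⟨ht.1.1.le, ht.1.2⟩)
    have hle2 : 16 / t ^ 2 / (N : ℝ) ≤ 16 / δ ^ 2 / N := by
      rw [← sq_abs t]; gcongr
    have hnn := fejerKernel_nonneg N t
    rw [Pi.zero_apply, dist_zero_left, Real.norm_of_nonneg (by positivity)]
    calc 1 / (2 * π) * fejerKernel N t ≤ 1 * fejerKernel N t := by
          gcongr
          rw [div_le_one (by positivity)]
          linarith [Real.pi_gt_three]
      _ < ε := by linarith
  · refine tendsto_const_nhds.congr' ?_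
    filter_upwards [eventually_gt_atTop 0] with N hN
    rw [← intervalIntegral.integral_of_le (by linarith), intervalIntegral.integral_const_mul,
      integral_fejerKernel hN]
    field_simp
  · exact (hf.comp (by fun_prop)).integrableOn_Ioc
  · have : Tendsto (fun t => f (x + t)) (nhds 0) (nhds (f x)) := by
      have := (hf.comp (continuous_const_add x)).tendsto 0
      simpa [Function.comp_def] using this
    exact this.mono_left nhdsWithin_le_nhds

/-! ### Representation of the deviation -/

theorem devCoef_zero (ψ : ℕ → ℝ) {n p : ℕ} (hp : 1 ≤ p) (hpn : p ≤ n) : devCoef ψ n p 0 = 0 := by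
  simp [devCoef, show 0 < n by omega]

theorem devFactor_mul_eq {ψ : ℕ → ℝ} (hψ : ∀ k, 1 ≤ k → 0 < ψ k) {n p : ℕ} (hp : 1 ≤ p)
    (hpn : p ≤ n) {k : ℕ} (hk : 1 ≤ k) :
    (if k < n then 1 - lambdaU ψ n p k else 1) * ψ k = devCoef ψ n p k := by
  unfold devCoef lambdaU
  split_ifs with h1 h2
  · simp [Nat.sub_eq_zero_of_le h2]
  · have := (hψ k hk).ne'
    have := (hψ n (by omega)).ne'
    have : (p : ℝ) ≠ 0 := by positivity
    rw [Nat.cast_sub (by omega), Nat.cast_sub hpn]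
    field_simp
    ring
  · rw [one_mul]

theorem sum_range_sub_sum_lambdaU {ψ : ℕ → ℝ} {n p N : ℕ} (hnN : n ≤ N) (u : ℕ → ℝ) :
    ∑ k ∈ Finset.range N, u k - ∑ k ∈ Finset.range n, lambdaU ψ n p k * u k =
      ∑ k ∈ Finset.range N, (if k < n then 1 - lambdaU ψ n p k else 1) * u k := by
  have h : ∑ k ∈ Finset.range n, lambdaU ψ n p k * u k =
      ∑ k ∈ Finset.range N, if k < n then lambdaU ψ n p k * u k else 0 := by
    rw [← Finset.sum_filter]
    congr 1
    ext k
    simp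
    omega
  rw [h, ← Finset.sum_sub_distrib]
  refine Finset.sum_congr rfl fun k _ => ?_
  split_ifs <;> ring

theorem sum_devCoef_integral_eq {φ : ℝ → ℝ} (hφ : IntervalIntegrable φ volume (-π) π)
    (ψ : ℕ → ℝ) (n p N : ℕ) (θ x : ℝ) :
    ∑ k ∈ Finset.range N, fejerWeight N k *
      (devCoef ψ n p k * (1 / π * ∫ t in (-π)..π, φ t * Real.cos (k * (t - x) + θ))) =
    1 / π * ∫ t in (-π)..π, φ t * devKernel ψ n p N θ (t - x) := by
  simp only [devKernel, Finset.mul_sum]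
  rw [intervalIntegral.integral_finsetSum fun k _ => hφ.mul_continuousOn (by fun_prop),
    Finset.mul_sum]
  refine Finset.sum_congr rfl fun k _ => ?_
  rw [mul_left_comm (devCoef ψ n p k), mul_left_comm (fejerWeight N k),
    ← intervalIntegral.integral_const_mul, ← intervalIntegral.integral_const_mul]
  congr 1
  refine intervalIntegral.integral_congr fun t _ => ?_
  ring

theorem SInf.intervalIntegrable {φ : ℝ → ℝ} (h : SInf φ) (a b : ℝ) :
    IntervalIntegrable φ volume a b := by
  refine (intervalIntegrable_const (c := (1 : ℝ))).mono_fun h.1.aestronglyMeasurable ?_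
  filter_upwards [ae_restrict_of_ae h.2.2] with t ht
  simpa using ht

theorem integral_mul_cos_add {φ : ℝ → ℝ} (hφ : IntervalIntegrable φ volume (-π) π) (k : ℕ)
    (θ x : ℝ) : 1 / π * ∫ t in (-π)..π, φ t * Real.cos (k * (t - x) + θ) =
      fourierA φ k * Real.cos (k * x - θ) + fourierB φ k * Real.sin (k * x - θ) := by
  have hc : IntervalIntegrable (fun t => φ t * Real.cos (k * t)) volume (-π) π :=
    hφ.mul_continuousOn (by fun_prop)
  have hs : IntervalIntegrable (fun t => φ t * Real.sin (k * t)) volume (-π) π :=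
    hφ.mul_continuousOn (by fun_prop)
  have : ∫ t in (-π)..π, φ t * Real.cos (k * (t - x) + θ) =
      Real.cos (k * x - θ) * (∫ t in (-π)..π, φ t * Real.cos (k * t)) +
      Real.sin (k * x - θ) * ∫ t in (-π)..π, φ t * Real.sin (k * t) := by
    rw [← intervalIntegral.integral_const_mul, ← intervalIntegral.integral_const_mul,
      ← intervalIntegral.integral_add (hc.const_mul _) (hs.const_mul _)]
    refine intervalIntegral.integral_congr fun t _ => ?_
    rw [show (k : ℝ) * (t - x) + θ = k * t - (k * x - θ) by ring, Real.cos_sub (k * t)]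
    ring
  rw [this, fourierA, fourierB]
  ring

theorem IsPsiDeriv.harmonicTerm_eq {ψ : ℕ → ℝ} {β : ℝ} {f φ : ℝ → ℝ} (h : IsPsiDeriv ψ β f φ)
    {k : ℕ} (hk : 1 ≤ k) (hψ : 0 < ψ k) (x : ℝ) : harmonicTerm f k x =
      ψ k * (1 / π * ∫ t in (-π)..π, φ t * Real.cos (k * (t - x) + β * π / 2)) := by
  obtain ⟨ha, hb⟩ := h.2.2 k hk
  rw [integral_mul_cos_add (h.1.intervalIntegrable _ _), ha, hb, harmonicTerm,
    if_neg (by omega), Real.cos_sub, Real.sin_sub]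
  field_simp
  linear_combination (-fourierA f k * Real.cos (k * x) - fourierB f k * Real.sin (k * x)) *
    Real.cos_sq_add_sin_sq (β * π / 2)

theorem IsPsiDeriv.fejerMean_sub_eq {ψ : ℕ → ℝ} (hψ : ∀ k, 1 ≤ k → 0 < ψ k) {β : ℝ}
    {f φ : ℝ → ℝ} (h : IsPsiDeriv ψ β f φ) {n p N : ℕ} (hp : 1 ≤ p) (hpn : p ≤ n) (hnN : n ≤ N)
    (x : ℝ) : fejerMean N f x -
      ∑ k ∈ Finset.range n, lambdaU ψ n p k * (fejerWeight N k * harmonicTerm f k x) =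
      1 / π * ∫ t in (-π)..π, φ t * devKernel ψ n p N (β * π / 2) (t - x) := by
  rw [fejerMean, sum_range_sub_sum_lambdaU hnN,
    ← sum_devCoef_integral_eq (h.1.intervalIntegrable _ _)]
  refine Finset.sum_congr rfl fun k _ => ?_
  rcases Nat.eq_zero_or_pos k with rfl | hk
  · rw [devCoef_zero ψ hp hpn, if_pos (by omega), lambdaU, if_pos (Nat.zero_le _)]
    simp
  · rw [h.harmonicTerm_eq hk (hψ k hk), ← devFactor_mul_eq hψ hp hpn hk]
    ring

theorem devKernel_periodic (ψ : ℕ → ℝ) (n p N : ℕ) (θ : ℝ) :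
    Function.Periodic (devKernel ψ n p N θ) (2 * π) := fun t => by
  refine Finset.sum_congr rfl fun k _ => ?_
  rw [show (k : ℝ) * (t + 2 * π) + θ = k * t + θ + k * (2 * π) by ring,
    Real.cos_add_nat_mul_two_pi]

theorem tendsto_fejerWeight (k : ℕ) : Tendsto (fun N => fejerWeight N k) atTop (nhds 1) := by
  have h : Tendsto (fun N : ℕ => 1 - (k : ℝ) / N) atTop (nhds (1 - 0)) :=
    tendsto_const_nhds.sub (tendsto_const_div_atTop_nhds_zero_nat _)
  rw [sub_zero] at h
  refine h.congr' ?_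
  filter_upwards [eventually_ge_atTop k] with N hN
  rw [fejerWeight_of_le hN]

theorem abs_sub_Usum_le {ψ : ℕ → ℝ} (hψ : ∀ k, 1 ≤ k → 0 < ψ k) {β : ℝ} {f : ℝ → ℝ}
    (hf : ClassC ψ β f) {n p : ℕ} (hp : 1 ≤ p) (hpn : p ≤ n) {B : ℝ}
    (hB : ∀ᶠ N in atTop, ∫ t in (-π)..π, |devKernel ψ n p N (β * π / 2) t| ≤ B) (x : ℝ) :
    |f x - Usum ψ n p f x| ≤ 1 / π * B := by
  obtain ⟨hcont, hper, φ, hφ⟩ := hf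
  have hlim : Tendsto (fun N => fejerMean N f x -
      ∑ k ∈ Finset.range n, lambdaU ψ n p k * (fejerWeight N k * harmonicTerm f k x)) atTop
      (nhds (f x - ∑ k ∈ Finset.range n, lambdaU ψ n p k * (1 * harmonicTerm f k x))) :=
    (tendsto_fejerMean hcont hper x).sub (tendsto_finsetSum _ fun k _ =>
      ((tendsto_fejerWeight k).mul_const _).const_mul _)
  simp only [one_mul] at hlim
  refine le_of_tendsto hlim.abs ?_
  filter_upwards [hB, eventually_ge_atTop n] with N hN hnN
  rw [hφ.fejerMean_sub_eq hψ hp hpn hnN, abs_mul, abs_of_pos (by positivity)]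
  gcongr
  refine le_trans ?_ hN
  have hper' : Function.Periodic (fun t => |devKernel ψ n p N (β * π / 2) t|) (2 * π) :=
    fun t => congrArg _ (devKernel_periodic ψ n p N _ t)
  rw [← integral_sub_eq_of_periodic hper' x, ← Real.norm_eq_abs]
  refine intervalIntegral.norm_integral_le_of_norm_le (by linarith [Real.pi_pos]) ?_
    (Continuous.intervalIntegrable
      (((continuous_devKernel ψ n p N _).comp (by fun_prop : Continuous fun t => t - x)).abs) _ _)
  filter_upwards [hφ.1.2.2] with t ht _
  rw [norm_mul, Real.norm_eq_abs, Real.norm_eq_abs]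
  exact mul_le_of_le_one_left (abs_nonneg _) ht

/-! ### Trigonometric polynomials -/

theorem integral_cos_intMul {m : ℤ} (hm : m ≠ 0) (c : ℝ) :
    ∫ t in (-π)..π, Real.cos (m * t + c) = 0 := by
  obtain ⟨k, rfl | rfl⟩ := m.eq_nat_or_neg
  · exact_mod_cast integral_cos_natMul (k := k) (by simpa using hm) c
  · rw [← integral_cos_natMul (k := k) (by simpa using hm) (-c)]
    refine intervalIntegral.integral_congr fun t _ => ?_
    rw [← Real.cos_neg]
    congr 1
    push_cast
    ring

theorem integral_cos_mul_cos (j k : ℕ) (hk : k ≠ 0) (c d : ℝ) :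
    ∫ t in (-π)..π, Real.cos (j * t + c) * Real.cos (k * t + d) =
      if j = k then π * Real.cos (c - d) else 0 := by
  have h : ∀ t : ℝ, Real.cos (j * t + c) * Real.cos (k * t + d) =
      1 / 2 * Real.cos (((j + k : ℤ) : ℝ) * t + (c + d)) +
        1 / 2 * Real.cos (((j - k : ℤ) : ℝ) * t + (c - d)) := fun t => by
    rw [show (((j + k : ℤ) : ℝ) * t + (c + d)) = (j * t + c) + (k * t + d) by push_cast; ring,
      show (((j - k : ℤ) : ℝ) * t + (c - d)) = (j * t + c) - (k * t + d) by push_cast; ring,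
      Real.cos_add (j * t + c), Real.cos_sub (j * t + c)]
    ring
  simp only [h]
  rw [intervalIntegral.integral_add (Continuous.intervalIntegrable (by fun_prop) _ _)
    (Continuous.intervalIntegrable (by fun_prop) _ _), intervalIntegral.integral_const_mul,
    intervalIntegral.integral_const_mul, integral_cos_intMul (by omega)]
  split_ifs with hjk
  · subst hjk
    simp
    ring
  · rw [integral_cos_intMul (by omega)]
    simp

/-- The trigonometric polynomial with coefficients `a`, `b`. -/
def trigPoly (N : ℕ) (a b : ℕ → ℝ) (x : ℝ) : ℝ :=
  ∑ k ∈ Finset.range N, (a k * Real.cos (k * x) + b k * Real.sin (k * x))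

theorem continuous_trigPoly (N : ℕ) (a b : ℕ → ℝ) : Continuous (trigPoly N a b) := by
  unfold trigPoly; fun_prop

theorem trigPoly_periodic (N : ℕ) (a b : ℕ → ℝ) : Periodic2pi (trigPoly N a b) := fun x => by
  refine Finset.sum_congr rfl fun k _ => ?_
  rw [mul_add, Real.cos_add_nat_mul_two_pi, Real.sin_add_nat_mul_two_pi]

theorem integral_trigPoly_mul_cos (N : ℕ) (a b : ℕ → ℝ) {k : ℕ} (hk : k ≠ 0) (d : ℝ) :
    ∫ t in (-π)..π, trigPoly N a b t * Real.cos (k * t + d) =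
      if k < N then π * (a k * Real.cos d - b k * Real.sin d) else 0 := by
  have hterm : ∀ j : ℕ, ∫ t in (-π)..π,
      (a j * Real.cos (j * t) + b j * Real.sin (j * t)) * Real.cos (k * t + d) =
      if j = k then π * (a k * Real.cos d - b k * Real.sin d) else 0 := fun j => by
    have h1 := integral_cos_mul_cos j k hk 0 d
    have h2 := integral_cos_mul_cos j k hk (-(π / 2)) d
    have : ∀ t : ℝ, (a j * Real.cos (j * t) + b j * Real.sin (j * t)) * Real.cos (k * t + d) =
        a j * (Real.cos (j * t + 0) * Real.cos (k * t + d)) +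
          b j * (Real.cos (j * t + -(π / 2)) * Real.cos (k * t + d)) := fun t => by
      rw [← sub_eq_add_neg (j * t), Real.cos_sub_pi_div_two, add_zero]
      ring
    simp only [this]
    rw [intervalIntegral.integral_add (Continuous.intervalIntegrable (by fun_prop) _ _)
      (Continuous.intervalIntegrable (by fun_prop) _ _), intervalIntegral.integral_const_mul,
      intervalIntegral.integral_const_mul, h1, h2]
    split_ifs with hjk
    · rw [hjk, zero_sub, Real.cos_neg, show -(π / 2) - d = -(d + π / 2) by ring, Real.cos_neg,
        Real.cos_add_pi_div_two]
      ring
    · simp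
  simp only [trigPoly, Finset.sum_mul]
  rw [intervalIntegral.integral_finsetSum
    fun j _ => Continuous.intervalIntegrable (by fun_prop) _ _]
  simp only [hterm]
  rw [Finset.sum_ite_eq' (Finset.range N) k]
  simp

theorem fourierA_trigPoly (N : ℕ) (a b : ℕ → ℝ) {k : ℕ} (hk : k ≠ 0) :
    fourierA (trigPoly N a b) k = if k < N then a k else 0 := by
  have h := integral_trigPoly_mul_cos N a b hk 0
  simp only [add_zero, Real.cos_zero, Real.sin_zero, mul_one, mul_zero, sub_zero] at h
  rw [fourierA, h]
  split_ifs
  · field_simp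
  · simp

theorem fourierB_trigPoly (N : ℕ) (a b : ℕ → ℝ) {k : ℕ} (hk : k ≠ 0) :
    fourierB (trigPoly N a b) k = if k < N then b k else 0 := by
  have h := integral_trigPoly_mul_cos N a b hk (-(π / 2))
  simp only [← sub_eq_add_neg, Real.cos_sub_pi_div_two, Real.cos_neg, Real.sin_neg,
    Real.cos_pi_div_two, Real.sin_pi_div_two] at h
  rw [fourierB, h]
  split_ifs
  · field_simp
    ring
  · simp

theorem fourierA_trigPoly_zero (N : ℕ) (a b : ℕ → ℝ) (ha : a 0 = 0) :
    fourierA (trigPoly N a b) 0 = 0 := by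
  simp only [fourierA, trigPoly, Nat.cast_zero, zero_mul, Real.cos_zero, mul_one]
  rw [intervalIntegral.integral_finsetSum
    fun j _ => Continuous.intervalIntegrable (by fun_prop) _ _, Finset.sum_eq_zero, mul_zero]
  intro k _
  rcases eq_or_ne k 0 with rfl | hk
  · simp [ha]
  · have h1 := integral_cos_natMul hk 0
    have h2 := integral_cos_natMul hk (-(π / 2))
    simp only [← sub_eq_add_neg, Real.cos_sub_pi_div_two, add_zero] at h1 h2
    rw [intervalIntegral.integral_add (Continuous.intervalIntegrable (by fun_prop) _ _)
      (Continuous.intervalIntegrable (by fun_prop) _ _), intervalIntegral.integral_const_mul,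
      intervalIntegral.integral_const_mul, h1, h2]
    simp

theorem exists_classC_sub_Usum_eq {ψ : ℕ → ℝ} (hψ : ∀ k, 1 ≤ k → 0 < ψ k) (β : ℝ) {φ : ℝ → ℝ}
    (hφ : IntervalIntegrable φ volume (-π) π) (h1 : ∀ t, |φ t| ≤ 1)
    (h0 : ∫ t in (-π)..π, φ t = 0) {n p N : ℕ} (hp : 1 ≤ p) (hpn : p ≤ n) (hnN : n ≤ N) :
    ∃ f, ClassC ψ β f ∧ f 0 - Usum ψ n p f 0 =
      1 / π * ∫ t in (-π)..π, φ t * devKernel ψ n p N (β * π / 2) t := by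
  set θ := β * π / 2 with hθ
  set a : ℕ → ℝ := fun k => fejerWeight N k * fourierA φ k with ha
  set b : ℕ → ℝ := fun k => fejerWeight N k * fourierB φ k with hb
  set a' : ℕ → ℝ := fun k => ψ k * (a k * Real.cos θ - b k * Real.sin θ) with ha'
  set b' : ℕ → ℝ := fun k => ψ k * (a k * Real.sin θ + b k * Real.cos θ) with hb'
  have hA0 : fourierA φ 0 = 0 := by simp [fourierA, h0]
  have hB0 : fourierB φ 0 = 0 := by simp [fourierB]
  have ha0 : a 0 = 0 := by simp [ha, hA0]
  have hb0 : b 0 = 0 := by simp [hb, hB0]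
  have ha'0 : a' 0 = 0 := by simp [ha', ha0, hb0]
  have hmean : fejerMean N φ = trigPoly N a b := by
    funext x
    refine Finset.sum_congr rfl fun k _ => ?_
    rcases eq_or_ne k 0 with rfl | hk
    · simp [harmonicTerm, hA0, ha0]
    · rw [harmonicTerm, if_neg hk]
      simp only [ha, hb]
      ring
  refine ⟨trigPoly N a' b', ⟨continuous_trigPoly _ _ _, trigPoly_periodic _ _ _, trigPoly N a b,
    ⟨(continuous_trigPoly _ _ _).measurable, trigPoly_periodic _ _ _,
      Eventually.of_forall fun t => ?_⟩, fourierA_trigPoly_zero _ _ _ ha0, fun k hk => ?_⟩, ?_⟩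
  · rw [← hmean]
    exact abs_fejerMean_le hφ h1 (by omega) t
  · have hk' : k ≠ 0 := by omega
    have hψk := (hψ k hk).ne'
    simp only [fourierA_trigPoly _ _ _ hk', fourierB_trigPoly _ _ _ hk', ← hθ]
    split_ifs
    · simp only [ha', hb']
      constructor
      · field_simp
        linear_combination (-a k) * Real.cos_sq_add_sin_sq θ
      · field_simp
        linear_combination (-b k) * Real.cos_sq_add_sin_sq θ
    · simp
  · have hterm : ∀ k ∈ Finset.range n, harmonicTerm (trigPoly N a' b') k 0 = a' k := by
      intro k hk
      have hkN : k < N := (Finset.mem_range.1 hk).trans_le hnN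
      rcases eq_or_ne k 0 with rfl | hk'
      · simp [harmonicTerm, fourierA_trigPoly_zero _ _ _ ha'0, ha'0]
      · simp [harmonicTerm, hk', fourierA_trigPoly _ _ _ hk', hkN]
    have hf0 : trigPoly N a' b' 0 = ∑ k ∈ Finset.range N, a' k := by simp [trigPoly]
    have hU : Usum ψ n p (trigPoly N a' b') 0 = ∑ k ∈ Finset.range n, lambdaU ψ n p k * a' k :=
      Finset.sum_congr rfl fun k hk => by rw [hterm k hk]
    rw [hf0, hU, sum_range_sub_sum_lambdaU hnN]
    have := sum_devCoef_integral_eq hφ ψ n p N θ 0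
    simp only [sub_zero] at this
    rw [← this]
    refine Finset.sum_congr rfl fun k _ => ?_
    rcases Nat.eq_zero_or_pos k with rfl | hk
    · rw [devCoef_zero ψ hp hpn, ha'0]
      simp
    · have h2 := integral_mul_cos_add hφ k θ 0
      simp only [sub_zero, mul_zero, zero_sub, Real.cos_neg, Real.sin_neg] at h2
      rw [h2, ← devFactor_mul_eq hψ hp hpn hk]
      simp only [ha', ha, hb]
      ring

theorem abs_real_sign_le (x : ℝ) : |Real.sign x| ≤ 1 := by
  rcases Real.sign_apply_eq x with h | h | h <;> simp [h]

theorem measurable_real_sign : Measurable Real.sign := by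
  unfold Real.sign
  exact Measurable.ite measurableSet_Iio measurable_const
    (Measurable.ite measurableSet_Ioi measurable_const measurable_const)

theorem integral_indicator_abs_le_one :
    ∫ t in (-π)..π, (if |t| ≤ 1 then (1 : ℝ) else 0) = 2 := by
  have hπ := Real.pi_gt_three
  have h : (fun t : ℝ => if |t| ≤ 1 then (1 : ℝ) else 0) = (Icc (-1) 1).indicator 1 := by
    funext t
    simp only [indicator, mem_Icc, abs_le, Pi.one_apply]
  rw [h, intervalIntegral.integral_of_le (by linarith), setIntegral_indicator measurableSet_Icc,
    show Ioc (-π) π ∩ Icc (-1) 1 = Icc (-1) 1 from inter_eq_right.2 fun t ht =>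
      ⟨by linarith [ht.1], by linarith [ht.2]⟩]
  simp
  norm_num

/-- A function bounded by one and supported in `[-1, 1]` can be balanced outside `[-1, 1]`
so that its mean over the period vanishes. -/
theorem exists_balanced_extension {s : ℝ → ℝ} (hm : Measurable s) (h1 : ∀ t, |s t| ≤ 1)
    (h0 : ∀ t, 1 < |t| → s t = 0) : ∃ φ : ℝ → ℝ, Measurable φ ∧ (∀ t, |φ t| ≤ 1) ∧
      (∀ t, |t| ≤ 1 → φ t = s t) ∧ ∫ t in (-π)..π, φ t = 0 := by
  have hπ := Real.pi_gt_three
  have hset : MeasurableSet {t : ℝ | |t| ≤ 1} := measurableSet_le measurable_norm measurable_const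
  have hs : IntervalIntegrable s volume (-π) π :=
    intervalIntegrable_of_measurable_of_norm_le hm (C := 1) h1 _ _
  have hi : IntervalIntegrable (fun t : ℝ => if |t| ≤ 1 then (1 : ℝ) else 0) volume (-π) π :=
    intervalIntegrable_of_measurable_of_norm_le
      (Measurable.ite hset measurable_const measurable_const) (C := 1)
      (fun t => by split_ifs <;> simp) _ _
  set S := ∫ t in (-π)..π, s t with hS
  have hSle : |S| ≤ 2 := by
    rw [← integral_indicator_abs_le_one, ← Real.norm_eq_abs]
    refine intervalIntegral.norm_integral_le_of_norm_le (by linarith)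
      (Eventually.of_forall fun t _ => ?_) hi
    split_ifs with ht
    · exact h1 t
    · simp [h0 t (not_le.1 ht)]
  set c := -S / (2 * π - 2) with hc
  have hcle : |c| ≤ 1 := by
    rw [hc, abs_div, abs_neg, abs_of_pos (by linarith : 0 < 2 * π - 2), div_le_one (by linarith)]
    linarith
  refine ⟨fun t => if |t| ≤ 1 then s t else c, Measurable.ite hset hm measurable_const,
    fun t => ?_, fun t ht => if_pos ht, ?_⟩
  · simp only
    split_ifs
    exacts [h1 t, hcle]
  · have : ∀ t, (if |t| ≤ 1 then s t else c) =
        s t + (c - c * (if |t| ≤ 1 then (1 : ℝ) else 0)) := fun t => by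
      split_ifs with ht
      · ring
      · rw [h0 t (not_le.1 ht)]; ring
    simp only [this]
    rw [intervalIntegral.integral_add hs (intervalIntegrable_const.sub (hi.const_mul c)),
      intervalIntegral.integral_sub intervalIntegrable_const (hi.const_mul c),
      intervalIntegral.integral_const_mul, integral_indicator_abs_le_one,
      intervalIntegral.integral_const, ← hS, smul_eq_mul]
    have : c * (2 * π - 2) = -S := by
      rw [hc, div_mul_cancel₀ _ (by linarith)]
    linarith

theorem modelKernel_eq_zero (D : ℝ) (n : ℕ) {p : ℕ} (hp : 1 ≤ p) {q : ℝ} (hq : 1 ≤ q) (θ : ℝ)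
    {t : ℝ} (ht : 1 < |t|) : modelKernel D n p q θ t = 0 := by
  have hp' : (1 : ℝ) ≤ p := by exact_mod_cast hp
  have h1 : 1 / (p : ℝ) < |t| := ((div_le_one (by linarith)).2 hp').trans_lt ht
  have h2 : 1 / q < |t| := ((div_le_one (by linarith)).2 hq).trans_lt ht
  simp [modelKernel, -one_div, h1, h2]

theorem real_sign_mul_self (x : ℝ) : Real.sign x * x = |x| := by
  rcases lt_trichotomy x 0 with h | rfl | h
  · rw [Real.sign_of_neg h, abs_of_neg h]; ring
  · simp
  · rw [Real.sign_of_pos h, abs_of_pos h]; ring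

theorem exists_bound_classSup :
    ∃ C > 0, ∀ (ψ : ℕ → ℝ) (β : ℝ) (n p : ℕ) (q A : ℝ), (∀ k, 1 ≤ k → 0 < ψ k) →
      RegularTail ψ n q A → 1 ≤ A → q ≤ A * n → 1 ≤ p → p ≤ n →
      |classSup ψ β (Usum ψ n p) - 4 / π ^ 2 * ψ n * (|Real.log p - Real.log q|)| ≤
        C * A * ψ n := by
  obtain ⟨C, hC0, hC⟩ := exists_bound_integral_symm_abs_modelKernel
  refine ⟨C + 178, by positivity, fun ψ β n p q A hψ hreg hA hqn hp hpn => ?_⟩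
  have hπ := Real.pi_gt_three
  have hD : 0 < ψ n := hψ n (by omega)
  set θ := β * π / 2 with hθ
  set m := modelKernel (ψ n) n p q θ with hm
  have hmI : IntervalIntegrable m volume (-π) π :=
    intervalIntegrable_modelKernel hD.le n p hreg.one_le hp θ _ _
  set I := ∫ t in (-π)..π, |m t| with hI
  set E := (36 * A + 142) * ψ n with hE
  have hdev : ∀ᶠ N in atTop, ∫ t in (-π)..π, |devKernel ψ n p N θ t - m t| ≤ E := by
    filter_upwards [eventually_ge_atTop (n ^ 2), eventually_ge_atTop n,
      tendsto_natCast_atTop_atTop.eventually_ge_atTop (n * q)] with N h1 h2 h3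
    exact integral_abs_devKernel_sub_modelKernel_le hp hpn hreg hD h1 h2 h3 θ
  have hdI : ∀ N, IntervalIntegrable (devKernel ψ n p N θ) volume (-π) π :=
    fun N => (continuous_devKernel ψ n p N θ).intervalIntegrable _ _
  have hupper : ∀ᶠ N in atTop, ∫ t in (-π)..π, |devKernel ψ n p N θ t| ≤ I + E := by
    filter_upwards [hdev] with N hN
    calc ∫ t in (-π)..π, |devKernel ψ n p N θ t|
        ≤ ∫ t in (-π)..π, (|m t| + |devKernel ψ n p N θ t - m t|) := by
          refine intervalIntegral.integral_mono_on (by linarith) (hdI N).abs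
            (hmI.abs.add ((hdI N).sub hmI).abs) fun t _ => ?_
          have := abs_add_le (m t) (devKernel ψ n p N θ t - m t)
          rwa [add_sub_cancel] at this
      _ = I + ∫ t in (-π)..π, |devKernel ψ n p N θ t - m t| :=
          intervalIntegral.integral_add hmI.abs ((hdI N).sub hmI).abs
      _ ≤ _ := by linarith
  have hle : ∀ f, ClassC ψ β f → ∀ x, |f x - Usum ψ n p f x| ≤ 1 / π * (I + E) :=
    fun f hf x => abs_sub_Usum_le hψ hf hp hpn hupper x
  have hlower : ∃ f, ClassC ψ β f ∧ 1 / π * (I - E) ≤ |f 0 - Usum ψ n p f 0| := by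
    obtain ⟨N, hN, hnN⟩ := (hdev.and (eventually_ge_atTop n)).exists
    obtain ⟨φ, hφm, hφ1, hφs, hφ0⟩ := exists_balanced_extension
      (s := fun t => Real.sign (m t))
      (measurable_real_sign.comp (measurable_modelKernel (ψ n) n p q θ))
      (fun t => abs_real_sign_le _)
      (fun t ht => by simp [hm, modelKernel_eq_zero (ψ n) n hp hreg.one_le θ ht])
    have hφI : IntervalIntegrable φ volume (-π) π :=
      intervalIntegrable_of_measurable_of_norm_le hφm (C := 1) hφ1 _ _
    obtain ⟨f, hf, hf0⟩ := exists_classC_sub_Usum_eq hψ β hφI hφ1 hφ0 hp hpn hnN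
    refine ⟨f, hf, le_trans ?_ (le_abs_self _)⟩
    rw [hf0]
    gcongr
    have hφd : IntervalIntegrable (fun t => φ t * devKernel ψ n p N θ t) volume (-π) π :=
      hφI.mul_continuousOn (continuous_devKernel ψ n p N θ).continuousOn
    calc I - E ≤ I - ∫ t in (-π)..π, |devKernel ψ n p N θ t - m t| := by linarith
      _ = ∫ t in (-π)..π, (|m t| - |devKernel ψ n p N θ t - m t|) :=
          (intervalIntegral.integral_sub hmI.abs ((hdI N).sub hmI).abs).symm
      _ ≤ ∫ t in (-π)..π, φ t * devKernel ψ n p N θ t := by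
          refine intervalIntegral.integral_mono_on (by linarith)
            (hmI.abs.sub ((hdI N).sub hmI).abs) hφd fun t _ => ?_
          have h1 : φ t * m t = |m t| := by
            rcases le_or_gt |t| 1 with ht | ht
            · rw [hφs t ht, real_sign_mul_self]
            · simp [hm, modelKernel_eq_zero (ψ n) n hp hreg.one_le θ ht]
          have h2 : -|devKernel ψ n p N θ t - m t| ≤ φ t * (devKernel ψ n p N θ t - m t) := by
            refine le_trans (neg_le_neg ?_) (neg_abs_le _)
            rw [abs_mul]
            exact mul_le_of_le_one_left (abs_nonneg _) (hφ1 t)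
          rw [mul_sub, h1] at h2
          linarith
  have hsup : ∀ f, ClassC ψ β f → ⨆ x, |f x - Usum ψ n p f x| ≤ 1 / π * (I + E) :=
    fun f hf => ciSup_le (hle f hf)
  obtain ⟨f, hf, hf0⟩ := hlower
  have hc1 : classSup ψ β (Usum ψ n p) ≤ 1 / π * (I + E) := by
    refine csSup_le ⟨_, f, hf, rfl⟩ ?_
    rintro e ⟨g, hg, rfl⟩
    exact hsup g hg
  have hc2 : 1 / π * (I - E) ≤ classSup ψ β (Usum ψ n p) := by
    refine hf0.trans ((le_ciSup (f := fun x => |f x - Usum ψ n p f x|) ?_ 0).trans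
      (le_csSup ?_ ⟨f, hf, rfl⟩))
    · exact ⟨_, by rintro _ ⟨x, rfl⟩; exact hle f hf x⟩
    · refine ⟨1 / π * (I + E), ?_⟩
      rintro e ⟨g, hg, rfl⟩
      exact hsup g hg
  have hmodel := abs_le.1 (hC (ψ n) n p q θ A hD.le hp hpn hreg.one_le hqn hA)
  set L := |Real.log p - Real.log q|
  have hmain : 4 / π ^ 2 * ψ n * L = 1 / π * (ψ n * (4 / π * L)) := by
    field_simp
  have hEle : E ≤ 178 * A * ψ n := by
    rw [hE]
    gcongr
    linarith
  have hinv : 1 / π ≤ 1 := (div_le_one (by linarith)).2 (by linarith)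
  have hR : 1 / π * (C * A * ψ n + E) ≤ (C + 178) * A * ψ n := by
    have hnn : 0 ≤ C * A * ψ n + E := by positivity
    nlinarith [mul_le_of_le_one_left hnn hinv]
  rw [hmain]
  have hpi : 0 ≤ 1 / π := by positivity
  have h1 := mul_le_mul_of_nonneg_left hmodel.1 hpi
  have h2 := mul_le_mul_of_nonneg_left hmodel.2 hpi
  rw [abs_le]
  constructor <;> linarith

/-! ### The characteristic `eta` -/

theorem MClass.strictAntiOn {ψ : ℝ → ℝ} (h : MClass ψ) : StrictAntiOn ψ (Ici 1) := by
  obtain ⟨hpos, hconv, hlim⟩ := h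
  intro x hx y hy hxy
  by_contra! hle
  have hge : ∀ z, y < z → ψ y ≤ ψ z := fun z hz => by
    have hs := hconv.slope_mono_adjacent hx ((mem_Ici.1 hy).trans hz.le) hxy hz
    have h0 : 0 ≤ (ψ y - ψ x) / (y - x) := div_nonneg (by linarith) (by linarith)
    have := (le_div_iff₀ (by linarith : 0 < z - y)).1 (h0.trans hs)
    linarith
  have := ge_of_tendsto hlim (eventually_atTop.2 ⟨y + 1, fun z hz => hge z (by linarith)⟩)
  exact absurd (hpos y hy) (not_lt.2 this)

theorem MClass.eta_spec {ψ : ℝ → ℝ} (h : MClass ψ) {t : ℝ} (ht : 1 < t) :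
    1 ≤ eta ψ t ∧ ψ (eta ψ t) = ψ t / 2 := by
  have hpos := h.1 t ht.le
  obtain ⟨z, hzt, hz⟩ :=
    ((eventually_gt_atTop t).and (h.2.2.eventually (gt_mem_nhds (half_pos hpos)))).exists
  have hcont : ContinuousOn ψ (Icc t z) :=
    ((h.2.1.subset Ioi_subset_Ici_self (convex_Ioi 1)).continuousOn isOpen_Ioi).mono
      fun x hx => ht.trans_le hx.1
  obtain ⟨w, hw, hwv⟩ := intermediate_value_Icc' hzt.le hcont
    (show ψ t / 2 ∈ Icc (ψ z) (ψ t) from ⟨hz.le, by linarith⟩)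
  have hex : ∃ a ∈ Ici (1 : ℝ), ψ a = ψ t / 2 := ⟨w, ht.le.trans hw.1, hwv⟩
  exact ⟨Function.invFunOn_mem hex, Function.invFunOn_eq hex⟩

theorem MClass.lt_eta {ψ : ℝ → ℝ} (h : MClass ψ) {t : ℝ} (ht : 1 < t) : t < eta ψ t := by
  obtain ⟨h1, h2⟩ := h.eta_spec ht
  have hpos := h.1 t ht.le
  exact (h.strictAntiOn.lt_iff_gt h1 ht.le).1 (by linarith)

theorem FClass.exists_eta_sub_le {ψ : ℝ → ℝ} (h : FClass ψ) :
    ∃ K : ℝ, 1 ≤ K ∧ ∀ x y, 1 ≤ x → x ≤ y → eta ψ y - eta ψ x ≤ K * (y - x) := by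
  obtain ⟨-, K, hK⟩ := h
  refine ⟨max 1 K, le_max_left _ _, fun x y hx hxy => ?_⟩
  refine (convex_Ici (1 : ℝ)).image_sub_le_mul_sub_of_deriv_le
    (fun t ht => (hK t ht).1.continuousAt.continuousWithinAt)
    (fun t ht => (hK t (interior_subset ht)).1.differentiableWithinAt)
    (fun t ht => (hK t (interior_subset ht)).2.trans (le_max_right _ _)) x hx y
    (hx.trans hxy) hxy

section

variable {ψ : ℝ → ℝ} {K : ℝ}

theorem MClass.sub_succ_le (h : MClass ψ)
    (hK : ∀ x y, 1 ≤ x → x ≤ y → eta ψ y - eta ψ x ≤ K * (y - x)) {t : ℝ} (ht : 1 < t) :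
    ψ t - ψ (t + 1) ≤ K * ψ t / (eta ψ t - t) := by
  obtain ⟨h1, h2⟩ := h.eta_spec ht
  obtain ⟨h1', h2'⟩ := h.eta_spec (show 1 < t + 1 by linarith)
  have hT := h.lt_eta ht
  have hanti := h.strictAntiOn ht.le (show (1 : ℝ) ≤ t + 1 by linarith) (by linarith : t < t + 1)
  have hlt : eta ψ t < eta ψ (t + 1) := (h.strictAntiOn.lt_iff_gt h1' h1).1 (by linarith)
  have hs := h.2.1.slope_mono_adjacent ht.le h1' hT hlt
  have hd := hK t (t + 1) ht.le (by linarith)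
  have hpos := h.1 t ht.le
  rw [h2, h2', div_le_div_iff₀ (by linarith) (by linarith)] at hs
  rw [le_div_iff₀ (by linarith)]
  nlinarith

theorem MClass.le_half_pow_mul (h : MClass ψ)
    (hK : ∀ x y, 1 ≤ x → x ≤ y → eta ψ y - eta ψ x ≤ K * (y - x)) {t : ℝ} (ht : 1 < t)
    {Q L : ℕ} (hQ : eta ψ t - t ≤ Q) (hL : 1 + K ≤ L) (hL1 : 1 ≤ L) (m : ℕ) :
    ψ (t + Q * L ^ m) ≤ (1 / 2) ^ m * ψ t := by
  have hL1' : (1 : ℝ) ≤ L := by exact_mod_cast hL1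
  induction m with
  | zero =>
    rw [pow_zero, pow_zero, mul_one, one_mul]
    exact h.strictAntiOn.antitoneOn ht.le (show (1 : ℝ) ≤ t + Q by
      have : (0 : ℝ) ≤ Q := by positivity
      linarith) (by simp)
  | succ m ih =>
    set s : ℝ := Q * L ^ m with hs
    have hs0 : 0 ≤ s := by positivity
    have hQs : (Q : ℝ) ≤ s := le_mul_of_one_le_right (by positivity) (one_le_pow₀ hL1')
    have hts : 1 < t + s := by linarith
    obtain ⟨h1, h2⟩ := h.eta_spec hts
    have hd := hK t (t + s) ht.le (by linarith)
    have hle : eta ψ (t + s) ≤ t + Q * L ^ (m + 1) := by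
      have : (Q : ℝ) * L ^ (m + 1) = s * L := by rw [hs]; ring
      rw [this]
      nlinarith
    calc ψ (t + Q * L ^ (m + 1)) ≤ ψ (eta ψ (t + s)) :=
          h.strictAntiOn.antitoneOn h1 (h1.trans hle) hle
      _ = ψ (t + s) / 2 := h2
      _ ≤ (1 / 2) ^ (m + 1) * ψ t := by rw [pow_succ]; linarith

theorem MClass.sum_mul_min_le (h : MClass ψ)
    (hK : ∀ x y, 1 ≤ x → x ≤ y → eta ψ y - eta ψ x ≤ K * (y - x)) {t q : ℝ} (ht : 1 < t)
    (hq : 1 ≤ q) (hTq : eta ψ t - t ≤ q) {L : ℕ} (hL : 1 + K ≤ L) (hL2 : 2 ≤ L) (M : ℕ) :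
    ∑ j ∈ Finset.range M, ψ (t + j) * min (1 / q) (1 / ((j : ℝ) + 1)) ≤ (2 + 2 * L) * ψ t := by
  have hpos := h.1 t ht.le
  set Q := ⌈q⌉₊ with hQ
  have hqQ : q ≤ Q := Nat.le_ceil q
  have hQq : (Q : ℝ) < q + 1 := Nat.ceil_lt_add_one (by linarith)
  have hQ1 : 1 ≤ Q := Nat.one_le_ceil_iff.2 (by linarith)
  have hψj : ∀ j : ℕ, 0 < ψ (t + j) := fun j => h.1 _ (by
    have : (0 : ℝ) ≤ j := by positivity
    show (1 : ℝ) ≤ t + j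
    linarith)
  have hanti : ∀ s j : ℝ, 0 ≤ s → s ≤ j → ψ (t + j) ≤ ψ (t + s) := fun s j hs hsj =>
    h.strictAntiOn.antitoneOn (show (1 : ℝ) ≤ t + s by linarith)
      (show (1 : ℝ) ≤ t + j by linarith) (by linarith)
  have hblock : ∀ m, ∑ j ∈ Finset.range (Q * L ^ m),
      ψ (t + j) * min (1 / q) (1 / ((j : ℝ) + 1)) ≤
        (2 + 2 * L - 2 * L * (1 / 2) ^ m) * ψ t := fun m => by
    induction m with
    | zero =>
      calc ∑ j ∈ Finset.range (Q * L ^ 0), ψ (t + j) * min (1 / q) (1 / ((j : ℝ) + 1))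
          ≤ ∑ j ∈ Finset.range (Q * L ^ 0), ψ t * (1 / q) := by
            refine Finset.sum_le_sum fun j _ => ?_
            have := hanti 0 j le_rfl (by positivity)
            rw [add_zero] at this
            exact mul_le_mul this (min_le_left _ _) (by positivity) hpos.le
        _ = Q / q * ψ t := by
            simp
            ring
        _ ≤ _ := by
            gcongr
            rw [div_le_iff₀ (by linarith)]
            linarith
    | succ m ih =>
      have hle : Q * L ^ m ≤ Q * L ^ (m + 1) := by
        gcongr
        · omega
        · omega
      rw [← Finset.sum_range_add_sum_Ico _ hle]
      have hX : (0 : ℝ) < Q * L ^ m := by positivity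
      have hIco : ∑ j ∈ Finset.Ico (Q * L ^ m) (Q * L ^ (m + 1)),
          ψ (t + j) * min (1 / q) (1 / ((j : ℝ) + 1)) ≤ L * (1 / 2) ^ m * ψ t := by
        calc _ ≤ ∑ j ∈ Finset.Ico (Q * L ^ m) (Q * L ^ (m + 1)),
              (1 / 2) ^ m * ψ t * (1 / (Q * L ^ m : ℝ)) := by
              refine Finset.sum_le_sum fun j hj => ?_
              have hj' : (Q * L ^ m : ℝ) ≤ j := by exact_mod_cast (Finset.mem_Ico.1 hj).1
              refine mul_le_mul ((hanti _ _ hX.le hj').trans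
                (h.le_half_pow_mul hK ht (hTq.trans hqQ) hL (by omega) m)) ?_
                (by positivity) (by positivity)
              refine (min_le_right _ _).trans ?_
              gcongr
              linarith
          _ ≤ (Q * L ^ (m + 1) : ℝ) * ((1 / 2) ^ m * ψ t * (1 / (Q * L ^ m : ℝ))) := by
              rw [Finset.sum_const, Nat.card_Ico, nsmul_eq_mul]
              gcongr
              exact_mod_cast Nat.sub_le _ _
          _ = _ := by
              field_simp
              ring
      rw [pow_succ (1 / 2 : ℝ)]
      linarith
  have hML : M ≤ Q * L ^ M :=
    (Nat.lt_two_pow_self.le.trans (Nat.pow_le_pow_left hL2 M)).trans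
      (Nat.le_mul_of_pos_left _ hQ1)
  calc _ ≤ ∑ j ∈ Finset.range (Q * L ^ M), ψ (t + j) * min (1 / q) (1 / ((j : ℝ) + 1)) :=
        Finset.sum_le_sum_of_subset_of_nonneg (Finset.range_mono hML)
          fun j _ _ => mul_nonneg (hψj j).le (by positivity)
    _ ≤ _ := hblock M
    _ ≤ _ := by
        gcongr
        have : (0 : ℝ) ≤ 2 * L * (1 / 2) ^ M := by positivity
        linarith

theorem MClass.antitone_sub (h : MClass ψ) {n : ℕ} (hn : 1 ≤ n) :
    Antitone fun j : ℕ => ψ ((n + j : ℕ) : ℝ) - ψ ((n + (j + 1) : ℕ) : ℝ) := by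
  refine antitone_nat_of_succ_le fun j => ?_
  have hn' : (1 : ℝ) ≤ n := by exact_mod_cast hn
  have hj : (0 : ℝ) ≤ j := by positivity
  have := h.2.1.slope_mono_adjacent (x := (n + j : ℝ)) (y := (n + j + 1 : ℝ))
    (z := (n + j + 2 : ℝ)) (show (1 : ℝ) ≤ n + j by linarith)
    (show (1 : ℝ) ≤ n + j + 2 by linarith) (by linarith) (by linarith)
  rw [show (n + j + 1 - (n + j) : ℝ) = 1 by ring, show (n + j + 2 - (n + j + 1) : ℝ) = 1 by ring,
    div_one, div_one] at this
  push_cast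
  rw [show (n + (j + 1) : ℝ) = n + j + 1 by ring, show (n + (j + 1 + 1) : ℝ) = n + j + 2 by ring]
  linarith

theorem MClass.regularTail (h : MClass ψ) {n : ℕ} (hn : 1 ≤ n) {q A : ℝ} (hq : 1 ≤ q)
    (hstep : ψ n - ψ (n + 1) ≤ A * ψ n / q)
    (hsum : ∀ M, ∑ j ∈ Finset.range M, ψ (n + j) * min (1 / q) (1 / ((j : ℝ) + 1)) ≤ A * ψ n) :
    RegularTail (fun k : ℕ => ψ k) n q A := by
  have hn' : (1 : ℝ) ≤ n := by exact_mod_cast hn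
  have hmem : ∀ j : ℕ, ((n + j : ℕ) : ℝ) ∈ Ici (1 : ℝ) := fun j => by
    have : (0 : ℝ) ≤ j := by positivity
    push_cast
    exact show (1 : ℝ) ≤ n + j by linarith
  refine ⟨hq, fun j => (h.1 _ (hmem j)).le, fun i j hij => ?_, h.antitone_sub hn, ?_, fun M => ?_⟩
  · exact h.strictAntiOn.antitoneOn (hmem i) (hmem j) (by exact_mod_cast by omega)
  · push_cast
    exact hstep
  · push_cast
    exact hsum M

end

theorem FClass.exists_regularTail {ψ : ℝ → ℝ} (h : FClass ψ) : ∃ A : ℝ, 1 ≤ A ∧ ∀ n : ℕ, 1 ≤ n →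
    RegularTail (fun k : ℕ => ψ k) n (max 1 (eta ψ n - n)) A ∧ max 1 (eta ψ n - n) ≤ A * n := by
  obtain ⟨K, hK1, hK⟩ := h.exists_eta_sub_le
  have hM := h.1
  obtain ⟨L, hL⟩ := exists_nat_ge (1 + K)
  have hL2' : (2 : ℝ) ≤ L := by linarith
  have hL2 : 2 ≤ L := by exact_mod_cast hL2'
  set q₁ := max 1 (eta ψ 1 - 1) with hq₁
  set q₂ := max 1 (eta ψ 2 - 2) with hq₂
  have h1q₁ : 1 ≤ q₁ := le_max_left _ _
  have h1q₂ : 1 ≤ q₂ := le_max_left _ _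
  have hs₂ : ∀ M, ∑ j ∈ Finset.range M, ψ (2 + j) * min (1 / q₂) (1 / ((j : ℝ) + 1)) ≤
      (2 + 2 * L) * ψ 2 :=
    hM.sum_mul_min_le hK (by norm_num) h1q₂ (le_max_right _ _) hL hL2
  have hψ1 : 0 < ψ 1 := hM.1 1 le_rfl
  have hψ2 : 0 < ψ 2 := hM.1 2 (by norm_num)
  have hψ21 : ψ 2 ≤ ψ 1 := hM.strictAntiOn.antitoneOn (mem_Ici.2 le_rfl)
    (show (1 : ℝ) ≤ 2 by norm_num) (by norm_num)
  have hs₁ : ∀ M, ∑ j ∈ Finset.range M, ψ (1 + j) * min (1 / q₁) (1 / ((j : ℝ) + 1)) ≤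
      (1 + q₂ * (2 + 2 * L)) * ψ 1 := fun M => by
    have hnn : 0 ≤ q₂ * (2 + 2 * L) * ψ 1 := by positivity
    have hfirst : ψ (1 + (0 : ℕ)) * min (1 / q₁) (1 / (((0 : ℕ) : ℝ) + 1)) ≤ ψ 1 := by
      rw [Nat.cast_zero, add_zero]
      exact mul_le_of_le_one_right hψ1.le ((min_le_right _ _).trans (by norm_num))
    cases M with
    | zero =>
      rw [Finset.sum_range_zero]
      positivity
    | succ M =>
      rw [Finset.sum_range_succ']
      have hrest : ∑ j ∈ Finset.range M,
          ψ (1 + (j + 1 : ℕ)) * min (1 / q₁) (1 / (((j + 1 : ℕ) : ℝ) + 1)) ≤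
          q₂ * ∑ j ∈ Finset.range M, ψ (2 + j) * min (1 / q₂) (1 / ((j : ℝ) + 1)) := by
        rw [Finset.mul_sum]
        refine Finset.sum_le_sum fun j _ => ?_
        have hj : (0 : ℝ) ≤ j := by positivity
        push_cast
        rw [show (1 + (j + 1) : ℝ) = 2 + j by ring, mul_left_comm]
        have hψj : 0 ≤ ψ (2 + j) := (hM.1 _ (show (1 : ℝ) ≤ 2 + j by linarith)).le
        refine mul_le_mul_of_nonneg_left ((min_le_right _ _).trans ?_) hψj
        rw [mul_min_of_nonneg _ _ (by linarith), le_min_iff, mul_one_div_cancel (by linarith)]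
        constructor
        · rw [div_le_one (by linarith)]
          linarith
        · rw [mul_one_div, div_le_div_iff₀ (by linarith) (by linarith)]
          nlinarith
      have h3 : q₂ * ∑ j ∈ Finset.range M, ψ (2 + j) * min (1 / q₂) (1 / ((j : ℝ) + 1)) ≤
          q₂ * ((2 + 2 * L) * ψ 1) := by
        gcongr
        exact (hs₂ M).trans (by gcongr)
      linarith
  refine ⟨q₁ + (1 + q₂ * (2 + 2 * L)) + (|eta ψ 2| + K), ?_, fun n hn => ?_⟩
  · have : 0 ≤ q₂ * (2 + 2 * L) := by positivity
    linarith [abs_nonneg (eta ψ 2)]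
  set A := q₁ + (1 + q₂ * (2 + 2 * L)) + (|eta ψ 2| + K) with hA
  have hq₂L : 2 + 2 * (L : ℝ) ≤ q₂ * (2 + 2 * L) := le_mul_of_one_le_left (by positivity) h1q₂
  have hη := abs_nonneg (eta ψ 2)
  have hA1 : q₁ ≤ A := by linarith
  have hA2 : 1 + q₂ * (2 + 2 * L) ≤ A := by linarith
  have hA3 : |eta ψ 2| + K ≤ A := by linarith
  have hA4 : 2 + 2 * (L : ℝ) ≤ A := by linarith
  have hn' : (1 : ℝ) ≤ n := by exact_mod_cast hn
  rcases hn.eq_or_lt with rfl | hn2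
  · simp only [Nat.cast_one, mul_one, ← hq₁]
    refine ⟨hM.regularTail le_rfl h1q₁ ?_ fun M => ?_, hA1⟩
    · rw [Nat.cast_one, le_div_iff₀ (by linarith)]
      have : 0 < ψ (1 + 1) := hM.1 _ (by norm_num)
      nlinarith
    · rw [Nat.cast_one]
      exact (hs₁ M).trans (by gcongr)
  · have hn2' : (2 : ℝ) ≤ n := by exact_mod_cast hn2
    have hψn : 0 < ψ n := hM.1 _ hn'
    refine ⟨hM.regularTail hn (le_max_left _ _) ?_ fun M => ?_, max_le ?_ ?_⟩
    · have hψn1 : 0 < ψ (n + 1) := hM.1 _ (show (1 : ℝ) ≤ n + 1 by linarith)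
      have hKA : K ≤ A := by linarith
      rcases le_total (eta ψ n - n) 1 with hT | hT
      · rw [max_eq_left hT, div_one]
        nlinarith
      · rw [max_eq_right hT]
        refine (hM.sub_succ_le hK (by linarith)).trans ?_
        gcongr
    · exact (hM.sum_mul_min_le hK (by linarith) (le_max_left _ _) (le_max_right _ _) hL hL2 M).trans
        (by gcongr)
    · nlinarith
    · have := hK 2 n (by norm_num) hn2'
      have h2 := le_abs_self (eta ψ 2)
      nlinarith

theorem abs_log_sub_log_max_eq {p T : ℝ} (hp : 1 ≤ p) :
    |Real.log p - Real.log (max 1 T)| =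
      if T ≤ 1 then Real.log p else if T ≤ p then Real.log (p / T) else Real.log (T / p) := by
  split_ifs with h1 h2
  · rw [max_eq_left h1, Real.log_one, sub_zero, abs_of_nonneg (Real.log_nonneg hp)]
  · push Not at h1
    rw [max_eq_right h1.le, Real.log_div (by linarith) (by linarith), abs_of_nonneg]
    exact sub_nonneg.2 (Real.log_le_log (by linarith) h2)
  · push Not at h1 h2
    rw [max_eq_right h1.le, Real.log_div (by linarith) (by linarith), abs_sub_comm, abs_of_nonneg]
    exact sub_nonneg.2 (Real.log_le_log (by linarith) h2.le)

/-- Theorem 1: for `ψ ∈ F` there is `C = C(ψ) > 0` such that for all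
`β ∈ ℝ` and all `1 ≤ p ≤ n`,
`|E(C^ψ_{β,∞}; U^ψ_{n,p}) - (4/π²) ψ(n) A^ψ_{n,p}| ≤ C ψ(n)`, where `A^ψ_{n,p}` is
`ln p` if `T(n) ≤ 1`, `ln(p/T(n))` if `1 ≤ T(n) ≤ p`, `ln(T(n)/p)` if `T(n) ≥ p`,
with `T(n) = η(ψ;n) - n`. -/
theorem statement0 (ψ : ℝ → ℝ) (hψ : FClass ψ) :
    ∃ C > (0 : ℝ), ∀ (β : ℝ) (n p : ℕ), 1 ≤ p → p ≤ n →
      |classSup (fun k : ℕ => ψ k) β (Usum (fun k : ℕ => ψ k) n p) -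
        4 / π ^ 2 * ψ n *
          (if eta ψ n - n ≤ 1 then Real.log p
           else if eta ψ n - n ≤ p then Real.log (p / (eta ψ n - n))
           else Real.log ((eta ψ n - n) / p))| ≤ C * ψ n := by
  obtain ⟨C, hC0, hC⟩ := exists_bound_classSup
  obtain ⟨A, hA1, hA⟩ := hψ.exists_regularTail
  refine ⟨C * A, by positivity, fun β n p hp hpn => ?_⟩
  obtain ⟨hreg, hq⟩ := hA n (hp.trans hpn)
  have hp' : (1 : ℝ) ≤ p := by exact_mod_cast hp
  rw [← abs_log_sub_log_max_eq hp']
  exact hC (fun k : ℕ => ψ k) β n p _ A (fun k hk => hψ.1.1 k (by exact_mod_cast hk)) hreg hA1 hq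
    hp hpn
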